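/- arXiv:1507.08327 — 4 statements merged into one kernel-verified Lean document; each statement's English description precedes it below -/
import Mathlib

section
/- Let (X₁,μ₁),…,(Xₙ,μₙ) be σ-finite measure spaces with product (X,μ), let p₁,…,pₙ ∈ (0,∞], and let P be the double n-tuple with exponent pⱼ attached to the variable xⱼ. Suppose 1 ≤ j < n and pⱼ ≤ p_{j+1}, and let τ denote the transposition of j and j+1. Then for every nonnegative measurable function f on X, ‖f‖_P ≤ ‖f‖_{P·τ}. That is, computing the mixed norm with the jᵗʰ and (j+1)ᵗʰ steps interchanged (the larger exponent taken in the inner integral) gives a larger value. -/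
open MeasureTheory
open scoped ENNReal

/-- Take the `L^q` norm of `f` in the single variable `x_j`, with the convention that
an exponent `∞` is interpreted as the essential supremum in that variable.  The result
is a function of the remaining variables (constant in `x_j`). -/
noncomputable def normIn {n : ℕ} {X : Fin n → Type*} [∀ j, MeasurableSpace (X j)]
    (μ : ∀ j, Measure (X j)) (j : Fin n) (q : ℝ≥0∞)
    (f : (∀ k, X k) → ℝ≥0∞) : (∀ k, X k) → ℝ≥0∞ :=
  fun x =>
    if q = ∞ then essSup (fun t => f (Function.update x j t)) (μ j)
    else (∫⁻ t, f (Function.update x j t) ^ q.toReal ∂(μ j)) ^ (1 / q.toReal)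

/-- The mixed norm of `f` determined by a double `n`-tuple, given as the list of
(variable, exponent) pairs in the order of processing: first the `L^{p₁}` norm in the
first listed variable, then the `L^{p₂}` norm in the second listed variable, and so on.
After all `n` variables are processed the result is constant, and its value is
extracted as a supremum. -/
noncomputable def mixedNorm {n : ℕ} {X : Fin n → Type*} [∀ j, MeasurableSpace (X j)]
    (μ : ∀ j, Measure (X j)) (P : List (Fin n × ℝ≥0∞))
    (f : (∀ k, X k) → ℝ≥0∞) : ℝ≥0∞ :=
  ⨆ x, (P.foldl (fun g jq => normIn μ jq.1 jq.2 g) f) x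

section aux
variable {α β : Type*} [MeasurableSpace α] [MeasurableSpace β]

lemma aux_measurable_essSup {ν : Measure β} [SFinite ν] {F : α → β → ℝ≥0∞}
    (hF : Measurable (Function.uncurry F)) :
    Measurable fun x => essSup (F x) ν := by
  refine measurable_of_Iic fun a => ?_
  have h : (fun x => essSup (F x) ν) ⁻¹' Set.Iic a
      = (fun x => ν (Prod.mk x ⁻¹' {z : α × β | a < Function.uncurry F z})) ⁻¹' {0} := by
    ext x
    simp only [Set.mem_preimage, Set.mem_Iic, Set.mem_singleton_iff]
    constructor
    · intro hx
      have := (ENNReal.ae_le_essSup (μ := ν) (F x)).mono fun t ht => ht.trans hx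
      rw [ae_iff] at this
      simpa [Set.preimage] using this
    · intro hx
      refine essSup_le_of_ae_le _ ?_
      change ∀ᵐ t ∂ν, F x t ≤ a
      rw [ae_iff]
      simpa [Set.preimage] using hx
  rw [h]
  exact measurable_measure_prodMk_left (measurableSet_lt measurable_const hF)
    (measurableSet_singleton 0)

lemma aux_mink_of_finite {μ : Measure α} {ν : Measure β} [SFinite μ] [SFinite ν]
    {r : ℝ} (hr : 1 < r) {G : α → β → ℝ≥0∞} (hG : Measurable (Function.uncurry G))
    {h : β → ℝ≥0∞} (hh : Measurable h) (hle : ∀ t, h t ≤ ∫⁻ s, G s t ∂μ)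
    (hfin : ∫⁻ t, h t ^ r ∂ν ≠ ∞) :
    ∫⁻ t, h t ^ r ∂ν ≤ (∫⁻ s, (∫⁻ t, G s t ^ r ∂ν) ^ (1 / r) ∂μ) ^ r := by
  set I := ∫⁻ t, h t ^ r ∂ν with hI
  set A := ∫⁻ s, (∫⁻ t, G s t ^ r ∂ν) ^ (1 / r) ∂μ with hA
  have hr0 : 0 < r := by linarith
  have hconj : r.HolderConjugate (Real.conjExponent r) := Real.HolderConjugate.conjExponent hr
  set q := Real.conjExponent r with hq
  have hGs : ∀ s, Measurable (G s) := fun s => hG.comp measurable_prodMk_left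
  have hGt : ∀ t, Measurable fun s => G s t := fun t => hG.comp measurable_prodMk_right
  have hq1 : (r - 1) * q = r := by
    have := hconj.sub_one_mul_conj; linarith
  have key : I ≤ A * I ^ (1 / q) := by
    calc I ≤ ∫⁻ t, ∫⁻ s, G s t * h t ^ (r - 1) ∂μ ∂ν := by
          refine lintegral_mono fun t => ?_
          rw [lintegral_mul_const _ (hGt t)]
          calc h t ^ r = h t ^ (1 + (r - 1)) := by ring_nf
            _ = h t * h t ^ (r - 1) := by
              rw [ENNReal.rpow_add_of_nonneg _ _ (by norm_num) (by linarith), ENNReal.rpow_one]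
            _ ≤ _ := by gcongr; exact hle t
      _ = ∫⁻ s, ∫⁻ t, G s t * h t ^ (r - 1) ∂ν ∂μ := by
          rw [lintegral_lintegral_swap]
          refine Measurable.aemeasurable ?_
          have h1 : Measurable fun z : β × α => G z.2 z.1 := hG.comp measurable_swap
          exact h1.mul ((hh.comp measurable_fst).pow_const _)
      _ ≤ ∫⁻ s, (∫⁻ t, G s t ^ r ∂ν) ^ (1 / r) * I ^ (1 / q) ∂μ := by
          refine lintegral_mono fun s => ?_
          have := ENNReal.lintegral_mul_le_Lp_mul_Lq ν hconj (hGs s).aemeasurable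
            (hh.pow_const (r - 1)).aemeasurable
          simpa only [Pi.mul_apply, ← ENNReal.rpow_mul, hq1] using this
      _ = A * I ^ (1 / q) := by
          rw [lintegral_mul_const]
          exact (Measurable.lintegral_prod_right' (hG.pow_const r)).pow_const _
  by_cases h0 : I = 0
  · simp [h0]
  have hsum : 1 / r + 1 / q = 1 := by
    simpa using hconj.inv_add_inv_eq_one
  have h1 : I ^ (1 / r) * I ^ (1 / q) ≤ A * I ^ (1 / q) := by
    rw [← ENNReal.rpow_add _ _ h0 hfin, hsum, ENNReal.rpow_one]; exact key
  have h2 : I ^ (1 / r) ≤ A :=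
    (ENNReal.mul_le_mul_iff_left (by simp [h0, hfin]) (by simp [h0, hfin])).1 h1
  calc I = (I ^ (1 / r)) ^ r := by
        rw [← ENNReal.rpow_mul, one_div_mul_cancel hr0.ne', ENNReal.rpow_one]
    _ ≤ A ^ r := ENNReal.rpow_le_rpow h2 hr0.le

lemma aux_mink {μ : Measure α} {ν : Measure β} [SFinite μ] [SigmaFinite ν]
    {r : ℝ} (hr : 1 ≤ r) {G : α → β → ℝ≥0∞} (hG : Measurable (Function.uncurry G)) :
    ∫⁻ t, (∫⁻ s, G s t ∂μ) ^ r ∂ν ≤ (∫⁻ s, (∫⁻ t, G s t ^ r ∂ν) ^ (1 / r) ∂μ) ^ r := by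
  rcases hr.eq_or_lt with rfl | hr
  · simp only [ENNReal.rpow_one, div_one]
    exact (lintegral_lintegral_swap (f := fun t s => G s t)
      (hG.comp measurable_swap).aemeasurable).le
  have hr0 : 0 < r := by linarith
  set H : β → ℝ≥0∞ := fun t => ∫⁻ s, G s t ∂μ with hH
  have hHm : Measurable H := hG.lintegral_prod_left'
  let h : ℕ → β → ℝ≥0∞ := fun k => (spanningSets ν k).indicator fun t => min (H t) k
  have hhm : ∀ k, Measurable (h k) := fun k =>
    (hHm.min measurable_const).indicator (measurableSet_spanningSets ν k)
  have hmono : Monotone h := by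
    intro k l hkl t
    refine (Set.indicator_le_indicator_of_subset (monotone_spanningSets ν hkl)
      (fun _ => zero_le) t).trans ?_
    refine Set.indicator_le_indicator ?_
    gcongr
  have hlim : ∀ t, Filter.Tendsto (fun k => h k t ^ r) Filter.atTop (nhds (H t ^ r)) := by
    intro t
    refine (ENNReal.continuous_rpow_const.tendsto _).comp ?_
    have h1 : Filter.Tendsto (fun k : ℕ => min (H t) (k : ℝ≥0∞)) Filter.atTop (nhds (H t)) := by
      have := (tendsto_const_nhds (x := H t) (f := Filter.atTop)).min ENNReal.tendsto_nat_nhds_top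
      simpa using this
    refine h1.congr' ?_
    filter_upwards [Filter.eventually_ge_atTop (spanningSetsIndex ν t)] with k hk
    have : t ∈ spanningSets ν k :=
      monotone_spanningSets ν hk (mem_spanningSetsIndex ν t)
    simp [h, this]
  have hl := lintegral_tendsto_of_tendsto_of_monotone (μ := ν) (f := fun k t => h k t ^ r)
    (F := fun t => H t ^ r) (fun k => ((hhm k).pow_const r).aemeasurable)
    (ae_of_all _ fun t k l hkl => ENNReal.rpow_le_rpow (hmono hkl t) hr0.le)
    (ae_of_all _ hlim)
  refine le_of_tendsto' hl fun k => ?_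
  refine aux_mink_of_finite hr hG (hhm k) (fun t => ?_) ?_
  · exact Set.indicator_le' (fun t _ => min_le_left _ _) (fun t _ => zero_le) t
  · have : ∫⁻ t, h k t ^ r ∂ν ≤ ∫⁻ t, (spanningSets ν k).indicator (fun _ => (k : ℝ≥0∞) ^ r) t ∂ν := by
      refine lintegral_mono fun t => ?_
      by_cases ht : t ∈ spanningSets ν k
      · simp only [h, ht, Set.indicator_of_mem]
        exact ENNReal.rpow_le_rpow (min_le_right _ _) hr0.le
      · simp [h, ht, hr0]
    refine ne_top_of_le_ne_top ?_ this
    rw [lintegral_indicator_const (measurableSet_spanningSets ν k)]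
    exact ENNReal.mul_ne_top (ENNReal.rpow_ne_top_of_nonneg hr0.le (by simp))
      (measure_spanningSets_lt_top ν k).ne

/-- one-variable `L^q` functional -/
noncomputable def auxN (μ : Measure α) (q : ℝ≥0∞) (f : α → ℝ≥0∞) : ℝ≥0∞ :=
  if q = ∞ then essSup f μ else (∫⁻ t, f t ^ q.toReal ∂μ) ^ (1 / q.toReal)

lemma auxN_mono_ae {μ : Measure α} {q : ℝ≥0∞} {f g : α → ℝ≥0∞} (h : f ≤ᵐ[μ] g) :
    auxN μ q f ≤ auxN μ q g := by
  unfold auxN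
  split_ifs
  · exact essSup_mono_ae h
  · refine ENNReal.rpow_le_rpow (lintegral_mono_ae ?_) (by positivity)
    exact h.mono fun t ht => ENNReal.rpow_le_rpow ht (by positivity)

lemma auxN_measurable {ν : Measure β} [SFinite ν] {q : ℝ≥0∞} {F : α → β → ℝ≥0∞}
    (hF : Measurable (Function.uncurry F)) : Measurable fun x => auxN ν q (F x) := by
  unfold auxN
  split_ifs
  · exact aux_measurable_essSup hF
  · exact (Measurable.lintegral_prod_right' (hF.pow_const _)).pow_const _

lemma auxN_swap {μ : Measure α} {ν : Measure β} [SigmaFinite μ] [SigmaFinite ν]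
    {p q : ℝ≥0∞} (hp : 0 < p) (hpq : p ≤ q) {F : α → β → ℝ≥0∞}
    (hF : Measurable (Function.uncurry F)) :
    auxN ν q (fun t => auxN μ p fun s => F s t) ≤ auxN μ p fun s => auxN ν q (F s) := by
  by_cases hq : q = ∞
  · subst hq
    conv_lhs => rw [auxN, if_pos rfl]
    refine essSup_le_of_ae_le _ ?_
    have hm : Measurable fun s => auxN ν ∞ (F s) := auxN_measurable hF
    have h1 : ∀ᵐ s ∂μ, ∀ᵐ t ∂ν, F s t ≤ auxN ν ∞ (F s) := by
      refine ae_of_all _ fun s => ?_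
      simp only [auxN, if_true]
      exact ENNReal.ae_le_essSup (F s)
    rw [Measure.ae_ae_comm (p := fun s t => F s t ≤ auxN ν ∞ (F s))
      (measurableSet_le hF (hm.comp measurable_fst))] at h1
    exact h1.mono fun t ht => auxN_mono_ae ht
  · have hp' : p ≠ ∞ := ne_top_of_le_ne_top hq hpq
    have ha : 0 < p.toReal := ENNReal.toReal_pos hp.ne' hp'
    have hab : p.toReal ≤ q.toReal := ENNReal.toReal_mono hq hpq
    simp only [auxN, if_neg hq, if_neg hp']
    set a := p.toReal
    set b := q.toReal
    have hb : 0 < b := ha.trans_le hab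
    have := aux_mink (μ := μ) (ν := ν) (r := b / a) ((one_le_div ha).2 hab)
      (G := fun s t => F s t ^ a) (hF.pow_const a)
    have h2 := ENNReal.rpow_le_rpow this (z := 1 / b) (by positivity)
    simp only [← ENNReal.rpow_mul] at h2 ⊢
    have e1 : a * (b / a) = b := by field_simp
    have e2 : 1 / (b / a) = 1 / b * a := by field_simp
    have e3 : b / a * (1 / b) = 1 / a := by field_simp
    have e4 : 1 / a * b = b / a := by field_simp
    rw [e1, e2, e3] at h2
    rw [e4]
    exact h2

end aux

section aux2
variable {n : ℕ} {X : Fin n → Type*} [∀ j, MeasurableSpace (X j)]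

lemma normIn_eq_auxN (μ : ∀ j, Measure (X j)) (j : Fin n) (q : ℝ≥0∞)
    (f : (∀ k, X k) → ℝ≥0∞) (x : ∀ k, X k) :
    normIn μ j q f x = auxN (μ j) q fun t => f (Function.update x j t) := rfl

lemma normIn_mono (μ : ∀ j, Measure (X j)) (j : Fin n) (q : ℝ≥0∞)
    {f g : (∀ k, X k) → ℝ≥0∞} (h : f ≤ g) : normIn μ j q f ≤ normIn μ j q g := by
  intro x
  exact auxN_mono_ae (ae_of_all _ fun t => h _)

lemma normIn_measurable (μ : ∀ j, Measure (X j)) [∀ j, SigmaFinite (μ j)] (j : Fin n) (q : ℝ≥0∞)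
    {f : (∀ k, X k) → ℝ≥0∞} (hf : Measurable f) : Measurable (normIn μ j q f) :=
  auxN_measurable (F := fun x t => f (Function.update x j t)) (hf.comp measurable_update')

lemma normIn_swap (μ : ∀ j, Measure (X j)) [∀ j, SigmaFinite (μ j)] {i j : Fin n} (hij : i ≠ j)
    {p q : ℝ≥0∞} (hp : 0 < p) (hpq : p ≤ q)
    {f : (∀ k, X k) → ℝ≥0∞} (hf : Measurable f) :
    normIn μ j q (normIn μ i p f) ≤ normIn μ i p (normIn μ j q f) := by
  intro x
  simp only [normIn_eq_auxN]
  have hm : Measurable (Function.uncurry fun (s : X i) (t : X j) =>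
      f (Function.update (Function.update x i s) j t)) := by
    refine hf.comp (measurable_update'.comp (f := fun z : X i × X j =>
      (Function.update x i z.1, z.2)) ?_)
    exact ((measurable_update x).comp measurable_fst).prodMk measurable_snd
  have := auxN_swap (μ := μ i) (ν := μ j) hp hpq hm
  refine le_of_eq_of_le ?_ this
  simp only [Function.update_comm hij]

lemma foldl_normIn_mono (μ : ∀ j, Measure (X j)) (P : List (Fin n × ℝ≥0∞))
    {f g : (∀ k, X k) → ℝ≥0∞} (h : f ≤ g) :
    P.foldl (fun g jq => normIn μ jq.1 jq.2 g) f ≤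
      P.foldl (fun g jq => normIn μ jq.1 jq.2 g) g := by
  induction P generalizing f g with
  | nil => exact h
  | cons a P ih => exact ih (normIn_mono μ _ _ h)

lemma foldl_normIn_measurable (μ : ∀ j, Measure (X j)) [∀ j, SigmaFinite (μ j)]
    (P : List (Fin n × ℝ≥0∞)) {f : (∀ k, X k) → ℝ≥0∞} (h : Measurable f) :
    Measurable (P.foldl (fun g jq => normIn μ jq.1 jq.2 g) f) := by
  induction P generalizing f with
  | nil => exact h
  | cons a P ih => exact ih (normIn_measurable μ _ _ h)

lemma aux_list_split {γ : Type*} (L : List γ) (j : ℕ) (h : j + 1 < L.length) :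
    L = L.take j ++ L[j] :: L[j + 1] :: L.drop (j + 2) := by
  rw [← List.drop_eq_getElem_cons h, ← List.drop_eq_getElem_cons (by omega), List.take_append_drop]

end aux2

/-- If `p_j ≤ p_{j+1}` and `τ` is the transposition of `j` and `j+1`, then
`‖f‖_P ≤ ‖f‖_{P·τ}` for every nonnegative measurable `f`: interchanging the `j`ᵗʰ and
`(j+1)`ˢᵗ steps, taking the larger exponent in the inner integral, gives a larger
mixed norm. -/
theorem mixedNorm_adjacent_swap_le {n : ℕ} {X : Fin n → Type*}
    [∀ j, MeasurableSpace (X j)] (μ : ∀ j, Measure (X j)) [∀ j, SigmaFinite (μ j)]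
    (p : Fin n → ℝ≥0∞) (hp : ∀ j, 0 < p j)
    (j : Fin n) (hj : (j : ℕ) + 1 < n)
    (hle : p j ≤ p ⟨(j : ℕ) + 1, hj⟩)
    (f : (∀ k, X k) → ℝ≥0∞) (hf : Measurable f) :
    mixedNorm μ (List.ofFn fun k => (k, p k)) f ≤
      mixedNorm μ (List.ofFn fun k =>
        (Equiv.swap j ⟨(j : ℕ) + 1, hj⟩ k, p (Equiv.swap j ⟨(j : ℕ) + 1, hj⟩ k))) f := by
  set j' : Fin n := ⟨(j : ℕ) + 1, hj⟩ with hj'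
  have hne : j ≠ j' := by
    intro h
    have := congrArg Fin.val h
    simp [hj'] at this
  set L := List.ofFn fun k => (k, p k) with hL
  set L' := List.ofFn fun k => (Equiv.swap j j' k, p (Equiv.swap j j' k)) with hL'
  have hlen : L.length = n := by simp [hL]
  have hlen' : L'.length = n := by simp [hL']
  have hsw : ∀ k : Fin n, (k : ℕ) ≠ j → (k : ℕ) ≠ j + 1 → Equiv.swap j j' k = k := by
    intro k h1 h2
    refine Equiv.swap_apply_of_ne_of_ne (fun h => h1 (congrArg Fin.val h)) (fun h => h2 ?_)
    have := congrArg Fin.val h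
    simpa [hj'] using this
  have htake : L'.take j = L.take j := by
    refine List.ext_getElem (by simp [hlen, hlen']) fun i h1 h2 => ?_
    have hi : i < j := by
      rw [List.length_take] at h2; omega
    have hk := hsw ⟨i, by omega⟩ (by simp; omega) (by simp; omega)
    simp [hL, hL', hk]
  have hdrop : L'.drop (j + 2) = L.drop (j + 2) := by
    refine List.ext_getElem (by simp [hlen, hlen']) fun i h1 h2 => ?_
    have hi : j + 2 + i < n := by
      rw [List.length_drop, hlen] at h2; omega
    have hk := hsw ⟨j + 2 + i, hi⟩ (by simp; omega) (by simp; omega)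
    simp [hL, hL', hk]
  have e := aux_list_split L j (by omega)
  have e' := aux_list_split L' j (by omega)
  have g1 : L[(j : ℕ)]'(by omega) = (j, p j) := by simp [hL]
  have g2 : L[(j : ℕ) + 1]'(by omega) = (j', p j') := by simp [hL, hj']
  have g3 : L'[(j : ℕ)]'(by omega) = (j', p j') := by simp [hL']
  have g4 : L'[(j : ℕ) + 1]'(by omega) = (j, p j) := by
    simp only [hL', List.getElem_ofFn]
    rw [show (⟨(j : ℕ) + 1, hj⟩ : Fin n) = j' from rfl, Equiv.swap_apply_right]
  rw [g1, g2] at e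
  rw [g3, g4, htake, hdrop] at e'
  unfold mixedNorm
  refine iSup_mono fun x => ?_
  rw [e']
  conv_lhs => rw [e]
  rw [List.foldl_append, List.foldl_append]
  simp only [List.foldl_cons]
  exact foldl_normIn_mono μ _ (normIn_swap μ hne (hp j) hle (foldl_normIn_measurable μ _ hf)) x
end

section
/- Let (X₁,μ₁),…,(Xₙ,μₙ) be σ-finite measure spaces with product (X,μ), let p₁ ≥ p₂ ≥ ⋯ ≥ pₙ be exponents in (0,∞], and let P be the double n-tuple pairing pⱼ with xⱼ. Let P₁,…,P_m enumerate the orbit {P_σ : σ ∈ Sₙ} of P under permutations of the variables (exponents kept in the fixed decreasing order), modulo the identification of n-tuples differing only in the order of variables within a block of consecutive equal exponents. Let p̄ = (n⁻¹ Σ_{j=1}^n pⱼ⁻¹)⁻¹. Then for any nonnegative measurable functions f₁,…,f_m on X, ‖ ∏_{i=1}^m fᵢ^{1/m} ‖_{L^{p̄}(X)} ≤ ∏_{i=1}^m ‖fᵢ‖_{Pᵢ}^{1/m}. -/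
open MeasureTheory
open scoped ENNReal

/-- The `L^p` "norm" (for `0 < p ≤ ∞`) of a nonnegative function, the exponent `∞`
being interpreted as the essential supremum. -/
noncomputable def eNorm {α : Type*} [MeasurableSpace α] (μ : Measure α) (p : ℝ≥0∞)
    (g : α → ℝ≥0∞) : ℝ≥0∞ :=
  if p = ∞ then essSup g μ else (∫⁻ a, g a ^ p.toReal ∂μ) ^ (1 / p.toReal)


theorem shm_eNorm_mono {α : Type*} [MeasurableSpace α] (μ : Measure α) (q : ℝ≥0∞)
    {f g : α → ℝ≥0∞} (h : f ≤ᵐ[μ] g) : eNorm μ q f ≤ eNorm μ q g := by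
  unfold eNorm
  split_ifs with hq
  · exact essSup_mono_ae h
  · refine ENNReal.rpow_le_rpow (lintegral_mono_ae ?_) (by positivity)
    filter_upwards [h] with x hx
    exact ENNReal.rpow_le_rpow hx (by positivity)

theorem shm_measurable_eNorm {α β : Type*} [MeasurableSpace α] [MeasurableSpace β]
    (ν : Measure β) [SigmaFinite ν] (q : ℝ≥0∞) {g : α → β → ℝ≥0∞}
    (hg : Measurable (Function.uncurry g)) : Measurable fun x => eNorm ν q (g x) := by
  unfold eNorm
  split_ifs with hq
  · refine measurable_of_Ioi fun c => ?_
    have : (fun x => essSup (g x) ν) ⁻¹' Set.Ioi c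
        = (fun x => ν (Prod.mk x ⁻¹' (Function.uncurry g ⁻¹' Set.Ioi c))) ⁻¹' {0}ᶜ := by
      ext x
      simp only [Set.mem_preimage, Set.mem_Ioi, Set.mem_compl_iff, Set.mem_singleton_iff]
      rw [← not_le, not_iff_not]
      constructor
      · intro h
        have h2 : ∀ᵐ t ∂ν, g x t ≤ c := by
          filter_upwards [ENNReal.ae_le_essSup (μ := ν) (g x)] with t ht using ht.trans h
        rw [ae_iff] at h2
        simpa [Set.preimage, not_le] using h2
      · intro h
        refine essSup_le_of_ae_le c ?_
        change ∀ᵐ t ∂ν, g x t ≤ c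
        rw [ae_iff]
        simpa [Set.preimage, not_le] using h
    rw [this]
    exact measurable_measure_prodMk_left (hg measurableSet_Ioi)
      (MeasurableSet.singleton _).compl
  · exact (Measurable.lintegral_prod_right' (f := fun z : α × β => g z.1 z.2 ^ q.toReal)
      (hg.pow_const _)).pow_const _

/-- Minkowski's integral inequality. -/
theorem shm_minkowski {α β : Type*} [MeasurableSpace α] [MeasurableSpace β]
    (μ : Measure α) (ν : Measure β) [SigmaFinite μ] [SigmaFinite ν] {r : ℝ} (hr : 1 ≤ r)
    {h : α → β → ℝ≥0∞} (hh : Measurable (Function.uncurry h)) :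
    ∫⁻ t, (∫⁻ s, h s t ∂μ) ^ r ∂ν ≤ (∫⁻ s, (∫⁻ t, h s t ^ r ∂ν) ^ (1 / r) ∂μ) ^ r := by
  have hr0 : 0 < r := by linarith
  by_contra hcon
  push Not at hcon
  set R := ∫⁻ s, (∫⁻ t, h s t ^ r ∂ν) ^ (1 / r) ∂μ with hR
  rw [lintegral_eq_nnreal] at hcon
  simp_rw [lt_iSup_iff] at hcon
  obtain ⟨φ₀, hφ₀, hlt⟩ := hcon
  rw [← SimpleFunc.lintegral_eq_lintegral] at hlt
  obtain ⟨φ, hφ, hfin, hlt⟩ :=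
    SimpleFunc.exists_lt_lintegral_simpleFunc_of_lt_lintegral (f := φ₀) (by simpa using hlt)
  have hle : ∀ t, (φ t : ℝ≥0∞) ≤ (∫⁻ s, h s t ∂μ) ^ r := fun t =>
    le_trans (by exact_mod_cast hφ t) (hφ₀ t)
  set I := ∫⁻ t, (φ t : ℝ≥0∞) ∂ν with hI
  have hφm : Measurable fun t => (φ t : ℝ≥0∞) := φ.measurable.coe_nnreal_ennreal
  have hrr : 0 ≤ 1 - 1 / r := by
    rw [sub_nonneg, div_le_one hr0]; exact hr
  have h1 : I ≤ I ^ (1 - 1 / r) * R := by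
    calc I ≤ ∫⁻ t, (φ t : ℝ≥0∞) ^ (1 - 1 / r) * ∫⁻ s, h s t ∂μ ∂ν := by
          refine lintegral_mono fun t => ?_
          calc (φ t : ℝ≥0∞) = (φ t : ℝ≥0∞) ^ (1 - 1 / r) * (φ t : ℝ≥0∞) ^ (1 / r) := by
                rw [← ENNReal.rpow_add_of_nonneg _ _ hrr (by positivity)]; simp
            _ ≤ _ := by
                gcongr
                calc (φ t : ℝ≥0∞) ^ (1 / r) ≤ ((∫⁻ s, h s t ∂μ) ^ r) ^ (1 / r) :=
                      ENNReal.rpow_le_rpow (hle t) (by positivity)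
                  _ = _ := by
                      rw [← ENNReal.rpow_mul, mul_one_div_cancel hr0.ne', ENNReal.rpow_one]
      _ = ∫⁻ t, ∫⁻ s, (φ t : ℝ≥0∞) ^ (1 - 1 / r) * h s t ∂μ ∂ν := by
          refine lintegral_congr fun t => ?_
          rw [lintegral_const_mul]
          exact hh.comp (measurable_prodMk_right (y := t))
      _ = ∫⁻ s, ∫⁻ t, (φ t : ℝ≥0∞) ^ (1 - 1 / r) * h s t ∂ν ∂μ := by
          rw [lintegral_lintegral_swap]
          refine Measurable.aemeasurable ?_
          exact ((hφm.comp measurable_fst).pow_const _).mul (hh.comp measurable_swap)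
      _ ≤ ∫⁻ s, I ^ (1 - 1 / r) * (∫⁻ t, h s t ^ r ∂ν) ^ (1 / r) ∂μ := by
          refine lintegral_mono fun s => ?_
          have := ENNReal.lintegral_mul_norm_pow_le (μ := ν) (f := fun t => (φ t : ℝ≥0∞))
            (g := fun t => h s t ^ r) hφm.aemeasurable
            ((hh.comp (measurable_prodMk_left (x := s))).pow_const r).aemeasurable
            hrr (by positivity : 0 ≤ 1 / r) (by ring)
          simpa [← ENNReal.rpow_mul, mul_inv_cancel₀ hr0.ne'] using this
      _ = _ := by
          rw [lintegral_const_mul]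
          exact (Measurable.lintegral_prod_right' (f := fun z : α × β => h z.1 z.2 ^ r)
            (hh.pow_const _)).pow_const _
  have hI0 : I ≠ 0 := (lt_of_le_of_lt bot_le hlt).ne'
  have hIt : I ≠ ∞ := hfin.ne
  have h2 : I ^ (1 / r) ≤ R := by
    have e : I = I ^ (1 - 1 / r) * I ^ (1 / r) := by
      rw [← ENNReal.rpow_add _ _ hI0 hIt]; simp
    nth_rewrite 1 [e] at h1
    exact (ENNReal.mul_le_mul_iff_right (ENNReal.rpow_pos (pos_iff_ne_zero.2 hI0) hIt).ne'
      (ENNReal.rpow_ne_top_of_nonneg hrr hIt)).1 h1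
  have h3 : I ≤ R ^ r := by
    calc I = (I ^ (1 / r)) ^ r := by
          rw [← ENNReal.rpow_mul, one_div_mul_cancel hr0.ne', ENNReal.rpow_one]
      _ ≤ R ^ r := ENNReal.rpow_le_rpow h2 hr0.le
  exact absurd hlt (not_lt.2 h3)

theorem shm_eNorm_swap {α β : Type*} [MeasurableSpace α] [MeasurableSpace β]
    (μ : Measure α) (ν : Measure β) [SigmaFinite μ] [SigmaFinite ν] {p q : ℝ≥0∞}
    (hp : 0 < p) (hpq : p ≤ q)
    {g : α → β → ℝ≥0∞} (hg : Measurable (Function.uncurry g)) :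
    eNorm ν q (fun t => eNorm μ p (fun s => g s t))
      ≤ eNorm μ p (fun s => eNorm ν q (fun t => g s t)) := by
  by_cases hq : q = ∞
  · subst hq
    have hG : Measurable fun s => eNorm ν ∞ (fun t => g s t) := shm_measurable_eNorm ν ∞ hg
    have h1 : ∀ᵐ s ∂μ, ∀ᵐ t ∂ν, g s t ≤ eNorm ν ∞ (fun t => g s t) := by
      refine Filter.Eventually.of_forall fun s => ?_
      simp only [eNorm, if_true]
      exact ENNReal.ae_le_essSup _
    rw [Measure.ae_ae_comm] at h1
    · conv_lhs => rw [eNorm, if_pos rfl]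
      refine essSup_le_of_ae_le _ ?_
      filter_upwards [h1] with t ht
      exact shm_eNorm_mono μ p ht
    · exact measurableSet_le hg (hG.comp measurable_fst)
  · have hp' : p ≠ ∞ := ne_top_of_le_ne_top hq hpq
    have hp0 : 0 < p.toReal := ENNReal.toReal_pos hp.ne' hp'
    have hle : p.toReal ≤ q.toReal := ENNReal.toReal_mono hq hpq
    have hq0 : 0 < q.toReal := lt_of_lt_of_le hp0 hle
    simp only [eNorm, if_neg hq, if_neg hp']
    generalize p.toReal = a at *
    generalize q.toReal = b at *
    have key := shm_minkowski μ ν (r := b / a) ((one_le_div hp0).2 hle)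
      (h := fun s t => g s t ^ a) (hg.pow_const a)
    have e1 : 1 / a * b = b / a := by ring
    have e2 : a * (b / a) = b := by field_simp
    have e3 : 1 / b * a = 1 / (b / a) := by field_simp
    simp only [← ENNReal.rpow_mul, e1, e2, e3] at key ⊢
    calc _ ≤ ((∫⁻ (s : α), (∫⁻ (t : β), g s t ^ b ∂ν) ^ (1 / (b / a)) ∂μ) ^ (b / a)) ^ (1 / b) :=
          ENNReal.rpow_le_rpow key (by positivity)
      _ = _ := by
          rw [← ENNReal.rpow_mul]; congr 1; field_simp

/-- Generalised Hölder inequality. -/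
theorem shm_holder {α : Type*} [MeasurableSpace α] (μ : Measure α) {m : ℕ}
    (f : Fin m → α → ℝ≥0∞) (hf : ∀ i, Measurable (f i)) (q : Fin m → ℝ≥0∞) (hq : ∀ i, 0 < q i)
    (P : ℝ≥0∞) (hP0 : P ≠ 0) (hP : P⁻¹ = ∑ i, (m : ℝ≥0∞)⁻¹ * (q i)⁻¹) :
    eNorm μ P (fun x => ∏ i, f i x ^ ((1 : ℝ) / m)) ≤ ∏ i, eNorm μ (q i) (f i) ^ ((1 : ℝ) / m) := by
  classical
  have hinf : ∀ᵐ x ∂μ, ∀ i, q i = ∞ → f i x ≤ eNorm μ (q i) (f i) := by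
    rw [ae_all_iff]
    intro i
    by_cases h : q i = ∞
    · simp only [h, eNorm, if_true, true_imp_iff]
      exact ENNReal.ae_le_essSup _
    · simp [h]
  by_cases hPt : P = ∞
  · have hall : ∀ i, q i = ∞ := by
      intro i
      rw [hPt, ENNReal.inv_top] at hP
      have := (Finset.sum_eq_zero_iff.1 hP.symm) i (Finset.mem_univ i)
      simpa using this
    conv_lhs => rw [eNorm, if_pos hPt]
    refine essSup_le_of_ae_le _ ?_
    filter_upwards [hinf] with x hx
    exact Finset.prod_le_prod' fun i _ => ENNReal.rpow_le_rpow (hx i (hall i)) (by positivity)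
  · have ha0 : 0 < P.toReal := ENNReal.toReal_pos hP0 hPt
    have hPr : P.toReal⁻¹ = ∑ i with q i ≠ ∞, (m : ℝ)⁻¹ * (q i).toReal⁻¹ := by
      have := congrArg ENNReal.toReal hP
      rw [ENNReal.toReal_inv, ENNReal.toReal_sum] at this
      · rw [this, Finset.sum_filter]
        refine Finset.sum_congr rfl fun i _ => ?_
        split_ifs with h
        · simp
        · push Not at h
          simp [h]
      · intro i _
        refine ENNReal.mul_ne_top ?_ (by simpa using (hq i).ne')
        have : m ≠ 0 := by rintro rfl; exact i.elim0
        simpa using this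
    conv_lhs => rw [eNorm, if_neg hPt]
    set a := P.toReal with ha
    set S : Finset (Fin m) := Finset.univ.filter fun i => q i ≠ ∞ with hS
    set T : Finset (Fin m) := Finset.univ.filter fun i => ¬ q i ≠ ∞ with hT
    have hsplit : ∀ c : Fin m → ℝ≥0∞, ∏ i, c i = (∏ i ∈ S, c i) * ∏ i ∈ T, c i := fun c =>
      (Finset.prod_filter_mul_prod_filter_not _ _ _).symm
    have hbound : ∫⁻ x, (∏ i, f i x ^ ((1 : ℝ) / m)) ^ a ∂μ
        ≤ (∏ i, eNorm μ (q i) (f i) ^ ((1 : ℝ) / m)) ^ a := by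
      calc ∫⁻ x, (∏ i, f i x ^ ((1 : ℝ) / m)) ^ a ∂μ
          ≤ ∫⁻ x, (∏ i ∈ S, (f i x ^ (q i).toReal) ^ (a * ((m : ℝ)⁻¹ * (q i).toReal⁻¹))) *
              (∏ i ∈ T, eNorm μ (q i) (f i) ^ ((1 : ℝ) / m)) ^ a ∂μ := by
            refine lintegral_mono_ae ?_
            filter_upwards [hinf] with x hx
            rw [hsplit, ENNReal.mul_rpow_of_nonneg _ _ ha0.le]
            gcongr ?_ * ?_
            · rw [← ENNReal.prod_rpow_of_nonneg ha0.le]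
              refine le_of_eq (Finset.prod_congr rfl fun i hi => ?_)
              have hqi : (q i).toReal ≠ 0 :=
                (ENNReal.toReal_pos (hq i).ne' (Finset.mem_filter.1 hi).2).ne'
              rw [← ENNReal.rpow_mul, ← ENNReal.rpow_mul]
              congr 1
              field_simp
            · refine ENNReal.rpow_le_rpow (Finset.prod_le_prod' fun i hi => ?_) ha0.le
              refine ENNReal.rpow_le_rpow (hx i ?_) (by positivity)
              simpa using (Finset.mem_filter.1 hi).2
        _ = (∫⁻ x, (∏ i ∈ S, (f i x ^ (q i).toReal) ^ (a * ((m : ℝ)⁻¹ * (q i).toReal⁻¹))) ∂μ) *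
              (∏ i ∈ T, eNorm μ (q i) (f i) ^ ((1 : ℝ) / m)) ^ a := by
            rw [lintegral_mul_const]
            exact Finset.measurable_prod _ fun i _ => ((hf i).pow_const _).pow_const _
        _ ≤ (∏ i ∈ S, (∫⁻ x, f i x ^ (q i).toReal ∂μ) ^ (a * ((m : ℝ)⁻¹ * (q i).toReal⁻¹))) *
              (∏ i ∈ T, eNorm μ (q i) (f i) ^ ((1 : ℝ) / m)) ^ a := by
            gcongr
            refine ENNReal.lintegral_prod_norm_pow_le S
              (fun i _ => ((hf i).pow_const _).aemeasurable) ?_ (fun i _ => by positivity)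
            rw [← Finset.mul_sum, ← hPr, mul_inv_cancel₀ ha0.ne']
        _ = _ := by
            rw [hsplit, ENNReal.mul_rpow_of_nonneg _ _ ha0.le]
            congr 1
            rw [← ENNReal.prod_rpow_of_nonneg ha0.le]
            refine Finset.prod_congr rfl fun i hi => ?_
            rw [eNorm, if_neg (Finset.mem_filter.1 hi).2, ← ENNReal.rpow_mul, ← ENNReal.rpow_mul]
            congr 1
            ring
    calc _ ≤ ((∏ i, eNorm μ (q i) (f i) ^ ((1 : ℝ) / m)) ^ a) ^ (1 / a) :=
          ENNReal.rpow_le_rpow hbound (by positivity)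
      _ = _ := by rw [← ENNReal.rpow_mul, mul_one_div_cancel ha0.ne', ENNReal.rpow_one]

section ListPart

variable {n : ℕ} {X : Fin n → Type*} [∀ j, MeasurableSpace (X j)]
  (μ : ∀ j, Measure (X j)) [∀ j, SigmaFinite (μ j)]

theorem shm_normIn_eq {n : ℕ} {X : Fin n → Type*} [∀ j, MeasurableSpace (X j)]
    (μ : ∀ j, Measure (X j)) (j : Fin n) (q : ℝ≥0∞) (f : (∀ k, X k) → ℝ≥0∞) (x : ∀ k, X k) :
    normIn μ j q f x = eNorm (μ j) q (fun t => f (Function.update x j t)) := rfl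

theorem shm_normIn_mono {n : ℕ} {X : Fin n → Type*} [∀ j, MeasurableSpace (X j)]
    (μ : ∀ j, Measure (X j)) (j : Fin n) (q : ℝ≥0∞) {f g : (∀ k, X k) → ℝ≥0∞} (h : f ≤ g) :
    normIn μ j q f ≤ normIn μ j q g := fun x =>
  shm_eNorm_mono _ _ (Filter.Eventually.of_forall fun _ => h _)

theorem shm_normIn_measurable (j : Fin n) (q : ℝ≥0∞) {f : (∀ k, X k) → ℝ≥0∞}
    (hf : Measurable f) : Measurable (normIn μ j q f) :=
  shm_measurable_eNorm (μ j) q (g := fun x t => f (Function.update x j t))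
    (hf.comp measurable_update')

theorem shm_normIn_swap {j k : Fin n} (hjk : j ≠ k) {p q : ℝ≥0∞} (hp : 0 < p) (hpq : p ≤ q)
    {f : (∀ k, X k) → ℝ≥0∞} (hf : Measurable f) :
    normIn μ k q (normIn μ j p f) ≤ normIn μ j p (normIn μ k q f) := by
  intro x
  have hm : Measurable (Function.uncurry fun (s : X j) (t : X k) =>
      f (Function.update (Function.update x j s) k t)) := by
    refine hf.comp (measurable_update'.comp (Measurable.prodMk ?_ measurable_snd))
    exact (measurable_update x).comp measurable_fst
  have := shm_eNorm_swap (μ j) (μ k) hp hpq hm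
  refine le_trans (le_of_eq ?_) this
  rw [shm_normIn_eq]
  simp only [shm_normIn_eq]
  simp_rw [Function.update_comm hjk.symm]

/-- Iterated norm along a list. -/
noncomputable def shmFold {n : ℕ} {X : Fin n → Type*} [∀ j, MeasurableSpace (X j)]
    (μ : ∀ j, Measure (X j)) (P : List (Fin n × ℝ≥0∞))
    (f : (∀ k, X k) → ℝ≥0∞) : (∀ k, X k) → ℝ≥0∞ :=
  P.foldl (fun g jq => normIn μ jq.1 jq.2 g) f

theorem shmFold_cons {n : ℕ} {X : Fin n → Type*} [∀ j, MeasurableSpace (X j)]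
    (μ : ∀ j, Measure (X j)) (a : Fin n × ℝ≥0∞) (P : List (Fin n × ℝ≥0∞))
    (f : (∀ k, X k) → ℝ≥0∞) : shmFold μ (a :: P) f = shmFold μ P (normIn μ a.1 a.2 f) := rfl

theorem shmFold_append {n : ℕ} {X : Fin n → Type*} [∀ j, MeasurableSpace (X j)]
    (μ : ∀ j, Measure (X j)) (P Q : List (Fin n × ℝ≥0∞))
    (f : (∀ k, X k) → ℝ≥0∞) : shmFold μ (P ++ Q) f = shmFold μ Q (shmFold μ P f) := by
  simp [shmFold]

theorem shmFold_mono {n : ℕ} {X : Fin n → Type*} [∀ j, MeasurableSpace (X j)]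
    (μ : ∀ j, Measure (X j)) (P : List (Fin n × ℝ≥0∞)) {f g : (∀ k, X k) → ℝ≥0∞} (h : f ≤ g) :
    shmFold μ P f ≤ shmFold μ P g := by
  induction P generalizing f g with
  | nil => exact h
  | cons a P ih => exact ih (shm_normIn_mono μ _ _ h)

theorem shmFold_measurable (P : List (Fin n × ℝ≥0∞)) {f : (∀ k, X k) → ℝ≥0∞}
    (hf : Measurable f) : Measurable (shmFold μ P f) := by
  induction P generalizing f with
  | nil => exact hf
  | cons a P ih => exact ih (shm_normIn_measurable μ _ _ hf)

theorem shmFold_move (Q : List (Fin n × ℝ≥0∞)) (a : Fin n × ℝ≥0∞)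
    (hQ : ∀ b ∈ Q, b.1 ≠ a.1 ∧ 0 < b.2 ∧ b.2 ≤ a.2) {f : (∀ k, X k) → ℝ≥0∞}
    (hf : Measurable f) :
    normIn μ a.1 a.2 (shmFold μ Q f) ≤ shmFold μ Q (normIn μ a.1 a.2 f) := by
  induction Q generalizing f with
  | nil => exact le_rfl
  | cons b Q ih =>
    rw [shmFold_cons, shmFold_cons]
    have hb := hQ b (by simp)
    exact (ih (fun c hc => hQ c (by simp [hc])) (shm_normIn_measurable μ _ _ hf)).trans
      (shmFold_mono μ Q (shm_normIn_swap μ hb.1 hb.2.1 hb.2.2 hf))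

theorem shmFold_sort (P Q : List (Fin n × ℝ≥0∞)) (hPQ : Q.Perm P)
    (hnd : (P.map Prod.fst).Nodup) (hpos : ∀ b ∈ P, 0 < b.2)
    (hs : P.Pairwise fun a b => b.2 ≤ a.2) {f : (∀ k, X k) → ℝ≥0∞} (hf : Measurable f) :
    shmFold μ Q f ≤ shmFold μ P f := by
  induction P generalizing Q f with
  | nil => rw [List.perm_nil.1 hPQ]
  | cons a P ih =>
    obtain ⟨Q1, Q2, rfl⟩ := List.append_of_mem (hPQ.mem_iff.2 (by simp : a ∈ a :: P))
    have hperm : (Q1 ++ Q2).Perm P := (List.perm_middle.symm.trans hPQ).cons_inv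
    rw [List.map_cons, List.nodup_cons] at hnd
    rw [List.pairwise_cons] at hs
    have hmem : ∀ b ∈ Q1, b ∈ P := fun b hb => hperm.mem_iff.1 (by simp [hb])
    rw [shmFold_append, shmFold_cons, shmFold_cons]
    refine le_trans (shmFold_mono μ Q2 (shmFold_move μ Q1 a ?_ hf)) ?_
    · intro b hb
      refine ⟨fun h => hnd.1 ?_, hpos b (by simp [hmem b hb]), hs.1 b (hmem b hb)⟩
      rw [← h]
      exact List.mem_map_of_mem (hmem b hb)
    · rw [← shmFold_append]
      exact ih _ hperm hnd.2 (fun b hb => hpos b (by simp [hb])) hs.2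
        (shm_normIn_measurable μ _ _ hf)

theorem shmFold_holder {m : ℕ} (l : List (Fin n)) (f : Fin m → (∀ k, X k) → ℝ≥0∞)
    (hf : ∀ i, Measurable (f i)) (q : Fin m → Fin n → ℝ≥0∞) (hq : ∀ i j, 0 < q i j)
    (P : ℝ≥0∞) (hP : ∀ j : Fin n, P ≠ 0 ∧ P⁻¹ = ∑ i, (m : ℝ≥0∞)⁻¹ * (q i j)⁻¹) :
    shmFold μ (l.map fun j => (j, P)) (fun x => ∏ i, f i x ^ ((1 : ℝ) / m)) ≤
      fun x => ∏ i, shmFold μ (l.map fun j => (j, q i j)) (f i) x ^ ((1 : ℝ) / m) := by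
  induction l generalizing f with
  | nil => exact le_rfl
  | cons j l ih =>
    simp only [List.map_cons, shmFold_cons]
    refine le_trans (shmFold_mono μ _ ?_)
      (ih (fun i => normIn μ j (q i j) (f i)) fun i => shm_normIn_measurable μ _ _ (hf i))
    intro x
    exact shm_holder (μ j) (fun i t => f i (Function.update x j t))
      (fun i => (hf i).comp (measurable_update x)) (fun i => q i j) (fun i => hq i j) P
      (hP j).1 (hP j).2

theorem shmFold_finite {P : ℝ≥0∞} (hP0 : P ≠ 0) (hPt : P ≠ ∞) (l : List (Fin n)) (hl : l.Nodup)
    {g : (∀ k, X k) → ℝ≥0∞} (hg : Measurable g) (x : ∀ k, X k) :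
    shmFold μ (l.map fun j => (j, P)) g x =
      (lmarginal μ l.toFinset (fun y => g y ^ P.toReal) x) ^ (1 / P.toReal) := by
  have ha0 : 0 < P.toReal := ENNReal.toReal_pos hP0 hPt
  induction l using List.reverseRecOn generalizing x with
  | nil =>
    simp [shmFold, ← ENNReal.rpow_mul, mul_inv_cancel₀ ha0.ne']
  | append_singleton l j ih =>
    have hl' := List.nodup_append.1 hl
    have hj : j ∉ l.toFinset := by
      intro h
      exact hl'.2.2 j (by simpa using h) j (by simp) rfl
    have e : (l ++ [j]).toFinset = insert j l.toFinset := by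
      ext; simp
    rw [e, lmarginal_insert _ (hg.pow_const _) hj, List.map_append, shmFold_append]
    simp only [List.map_cons, List.map_nil, shmFold_cons]
    change normIn μ j P _ x = _
    rw [normIn, if_neg hPt]
    simp_rw [ih hl'.1, ← ENNReal.rpow_mul, one_div_mul_cancel ha0.ne', ENNReal.rpow_one]

theorem shmFold_top (l : List (Fin n)) (hl : l.Nodup) (c : ℝ≥0∞)
    {g : (∀ k, X k) → ℝ≥0∞} (hg : Measurable g) (x : ∀ k, X k)
    (hx : shmFold μ (l.map fun j => (j, ∞)) g x ≤ c) :
    lmarginal μ l.toFinset (Set.indicator {y | c < g y} 1) x = 0 := by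
  induction l using List.reverseRecOn generalizing x with
  | nil =>
    simpa [shmFold] using hx
  | append_singleton l j ih =>
    have hl' := List.nodup_append.1 hl
    have hj : j ∉ l.toFinset := by
      intro h
      exact hl'.2.2 j (by simpa using h) j (by simp) rfl
    have e : (l ++ [j]).toFinset = insert j l.toFinset := by
      ext; simp
    rw [e, lmarginal_insert _ (measurable_one.indicator (measurableSet_lt measurable_const hg)) hj]
    rw [List.map_append, shmFold_append] at hx
    simp only [List.map_cons, List.map_nil, shmFold_cons] at hx
    change normIn μ j ∞ _ x ≤ c at hx
    rw [normIn, if_pos rfl] at hx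
    rw [lintegral_congr_ae (g := fun _ => 0), lintegral_zero]
    filter_upwards [ENNReal.ae_le_essSup (μ := μ j) (fun t =>
      shmFold μ (l.map fun j => (j, ∞)) g (Function.update x j t))] with t ht
    exact ih hl'.1 _ (ht.trans hx)

theorem shm_eNorm_pi_le {P : ℝ≥0∞} (hP0 : P ≠ 0) {g : (∀ k, X k) → ℝ≥0∞} (hg : Measurable g)
    (x : ∀ k, X k) :
    eNorm (Measure.pi μ) P g ≤ shmFold μ ((List.finRange n).map fun j => (j, P)) g x := by
  have hu : (List.finRange n).toFinset = Finset.univ := by ext; simp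
  by_cases hPt : P = ∞
  · subst hPt
    rw [eNorm, if_pos rfl]
    have := shmFold_top μ (List.finRange n) (List.nodup_finRange n) _ hg x le_rfl
    have hms := measurableSet_lt (measurable_const
      (a := shmFold μ ((List.finRange n).map fun j => (j, ∞)) g x)) hg
    rw [hu, lmarginal_univ, lintegral_indicator_one hms] at this
    refine essSup_le_of_ae_le _ ?_
    change ∀ᵐ y ∂_, g y ≤ _
    rw [ae_iff]
    simpa only [not_le] using this
  · rw [shmFold_finite μ hP0 hPt _ (List.nodup_finRange n) hg, hu, lmarginal_univ, eNorm,
      if_neg hPt]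

end ListPart

theorem shm_average {n m : ℕ} (p : Fin n → ℝ≥0∞)
    (e : Fin m → Equiv.Perm (Fin n))
    (henum : ∀ σ : Equiv.Perm (Fin n),
      ∃! i : Fin m, (fun v => p ((e i)⁻¹ v)) = (fun v => p (σ⁻¹ v))) (v : Fin n) :
    (n : ℝ≥0∞)⁻¹ * ∑ j : Fin n, (p j)⁻¹ = ∑ i, (m : ℝ≥0∞)⁻¹ * (p ((e i)⁻¹ v))⁻¹ := by
  have hn : n ≠ 0 := by rintro rfl; exact v.elim0
  have hm : m ≠ 0 := by
    rintro rfl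
    obtain ⟨i, _⟩ := henum 1
    exact i.elim0
  have hS : ∀ w, ∑ i, (p ((e i)⁻¹ w))⁻¹ = ∑ i, (p ((e i)⁻¹ v))⁻¹ := by
    intro w
    let τ : Equiv.Perm (Fin n) := Equiv.swap v w
    choose φ hφ _ using fun i => henum (τ * e i)
    have hinj : Function.Injective φ := by
      intro i i' h
      have h1 := hφ i
      have h2 := hφ i'
      simp only at h1 h2
      rw [h, h2] at h1
      refine (henum (e i)).unique rfl ?_
      funext u
      have := congrFun h1 (τ u)
      simpa [mul_inv_rev, Equiv.Perm.mul_apply] using this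
    have hbij : Function.Bijective φ := Finite.injective_iff_bijective.1 hinj
    rw [← hbij.sum_comp (fun i => (p ((e i)⁻¹ w))⁻¹)]
    refine Finset.sum_congr rfl fun i _ => ?_
    have := congrFun (hφ i) w
    rw [this]
    simp [mul_inv_rev, Equiv.Perm.mul_apply, τ]
  have h1 : (n : ℝ≥0∞) * ∑ i, (p ((e i)⁻¹ v))⁻¹ = m * ∑ j, (p j)⁻¹ := by
    calc (n : ℝ≥0∞) * ∑ i, (p ((e i)⁻¹ v))⁻¹ = ∑ w : Fin n, ∑ i, (p ((e i)⁻¹ w))⁻¹ := by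
          simp_rw [hS]
          rw [Finset.sum_const, Finset.card_univ, Fintype.card_fin, nsmul_eq_mul]
      _ = ∑ i, ∑ w : Fin n, (p ((e i)⁻¹ w))⁻¹ := Finset.sum_comm
      _ = ∑ i : Fin m, ∑ j, (p j)⁻¹ :=
          Finset.sum_congr rfl fun i _ => Equiv.sum_comp (e i)⁻¹ fun j => (p j)⁻¹
      _ = _ := by simp
  have hn' : (n : ℝ≥0∞) ≠ 0 := by exact_mod_cast hn
  have hm' : (m : ℝ≥0∞) ≠ 0 := by exact_mod_cast hm
  rw [← Finset.mul_sum]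
  calc (n : ℝ≥0∞)⁻¹ * ∑ j : Fin n, (p j)⁻¹
      = (n : ℝ≥0∞)⁻¹ * ((m : ℝ≥0∞)⁻¹ * (m * ∑ j : Fin n, (p j)⁻¹)) := by
        rw [← mul_assoc (m : ℝ≥0∞)⁻¹, ENNReal.inv_mul_cancel hm' (by simp), one_mul]
    _ = (m : ℝ≥0∞)⁻¹ * (((n : ℝ≥0∞)⁻¹ * n) * ∑ i, (p ((e i)⁻¹ v))⁻¹) := by
        rw [← h1]; ring
    _ = _ := by rw [ENNReal.inv_mul_cancel hn' (by simp), one_mul]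

/-- Symmetric geometric-mean estimate, variables permuted: with `p₁ ≥ ⋯ ≥ pₙ` and
`P₁, …, P_m` (given by permutations `e 1, …, e m` of the variables, the exponents
staying in decreasing order) enumerating the orbit `{P_σ : σ ∈ Sₙ}` modulo the
identification of tuples assigning the same exponent to each variable (i.e. `P_σ` is
identified with `P_ρ` exactly when `p ∘ σ⁻¹ = p ∘ ρ⁻¹`), for the harmonic mean `p̄`
of the exponents, `‖∏ fᵢ^{1/m}‖_{L^{p̄}} ≤ ∏ ‖fᵢ‖_{Pᵢ}^{1/m}`. -/
theorem symmetric_holder_minkowski {n m : ℕ} {X : Fin n → Type*}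
    [∀ j, MeasurableSpace (X j)] (μ : ∀ j, Measure (X j)) [∀ j, SigmaFinite (μ j)]
    (p : Fin n → ℝ≥0∞) (hp : ∀ j, 0 < p j)
    (hdecr : ∀ i j : Fin n, i ≤ j → p j ≤ p i)
    (e : Fin m → Equiv.Perm (Fin n))
    (henum : ∀ σ : Equiv.Perm (Fin n),
      ∃! i : Fin m, (fun v => p ((e i)⁻¹ v)) = (fun v => p (σ⁻¹ v)))
    (f : Fin m → (∀ k, X k) → ℝ≥0∞) (hf : ∀ i, Measurable (f i)) :
    eNorm (Measure.pi μ) ((↑n)⁻¹ * ∑ j : Fin n, (p j)⁻¹)⁻¹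
        (fun x => ∏ i : Fin m, f i x ^ ((1 : ℝ) / m)) ≤
      ∏ i : Fin m,
        mixedNorm μ (List.ofFn fun j => (e i j, p j)) (f i) ^ ((1 : ℝ) / m) := by
  classical
  set P : ℝ≥0∞ := ((↑n)⁻¹ * ∑ j : Fin n, (p j)⁻¹)⁻¹ with hPdef
  have hP0 : P ≠ 0 := by
    rw [hPdef, Ne, ENNReal.inv_eq_zero]
    rcases Nat.eq_zero_or_pos n with rfl | hn
    · simp
    · refine ENNReal.mul_ne_top (by simpa using hn.ne') (ENNReal.sum_ne_top.2 fun j _ => ?_)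
      simpa using (hp j).ne'
  have hg : Measurable fun x => ∏ i : Fin m, f i x ^ ((1 : ℝ) / m) :=
    Finset.measurable_prod _ fun i _ => (hf i).pow_const _
  rcases isEmpty_or_nonempty (∀ k, X k) with hX | ⟨⟨x⟩⟩
  · have h0 : Measure.pi μ = 0 := Measure.eq_zero_of_isEmpty _
    rw [h0]
    refine le_trans (le_of_eq ?_) bot_le
    unfold eNorm
    split_ifs with h
    · exact essSup_measure_zero
    · have : 0 < P.toReal := ENNReal.toReal_pos hP0 h
      simp [this]
  · refine (shm_eNorm_pi_le μ hP0 hg x).trans ?_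
    refine (shmFold_holder μ (List.finRange n) f hf (fun i v => p ((e i)⁻¹ v))
      (fun i v => hp _) P (fun v => ⟨hP0, ?_⟩) x).trans ?_
    · rw [hPdef, inv_inv]
      exact shm_average p e henum v
    · refine Finset.prod_le_prod' fun i _ => ENNReal.rpow_le_rpow ?_ (by positivity)
      refine le_trans ?_ (le_iSup _ x)
      refine shmFold_sort μ (List.ofFn fun j => (e i j, p j)) _ ?_ ?_ ?_ ?_ (hf i) x
      · have h1 : (List.ofFn fun j => (e i j, p j))
            = ((List.finRange n).map (e i)).map fun v => (v, p ((e i)⁻¹ v)) := by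
          rw [List.ofFn_eq_map, List.map_map]
          simp [Function.comp_def]
        rw [h1]
        refine List.Perm.map _ ?_
        exact ((List.perm_ext_iff_of_nodup (List.nodup_finRange n)
          ((List.nodup_finRange n).map (e i).injective)).2 fun v => by
            simp only [List.mem_finRange, List.mem_map, true_and, true_iff]
            exact (e i).surjective v)
      · rw [List.map_ofFn]
        exact List.nodup_ofFn.2 (e i).injective
      · intro b hb
        obtain ⟨j, rfl⟩ := (List.mem_ofFn' _ _).1 hb
        exact hp j
      · rw [List.pairwise_ofFn]
        intro a b hab
        exact hdecr a b hab.le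
end

section
/- Generalized Blei inequality with exponents p and q: suppose 0 < p < q ≤ ∞, let J > K > 0 be integers, N = C(J,K), and let S₁,…,S_N enumerate the subsets of {1,…,J} of cardinality K, with ∼S_α = {1,…,J} \ S_α. For any σ-finite measure spaces (X₁,μ₁),…,(X_J,μ_J) and any measurable function f(x₁,…,x_J) on X₁ × ⋯ × X_J, ‖f‖_{Jpq/(pJ+(q−p)K)} ≤ ∏_{α=1}^{N} [ ∫_{S_α} ( ∫_{∼S_α} |f|^q )^{p/q} ]^{1/(Np)}, where the left-hand side is the L^{Jpq/(pJ+(q−p)K)} norm on the full product space and for E ⊂ {1,…,J} the notation ∫_E denotes integration over ∏_{k∈E} X_k with the product measure. -/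
open MeasureTheory
open scoped ENNReal

/-- Combine a point of `∏_{j ∈ E} X j` and a point of `∏_{j ∈ Eᶜ} X j` into a point of
the full product `∏ j, X j`. -/
def glue {n : ℕ} {X : Fin n → Type*} (E : Finset (Fin n))
    (a : ∀ j : E, X j) (b : ∀ j : (Eᶜ : Finset (Fin n)), X j) : ∀ j, X j :=
  fun j => if h : j ∈ E then a ⟨j, h⟩ else b ⟨j, Finset.mem_compl.mpr h⟩

/-- The exponent `Jpq/(pJ + (q-p)K)`, written as the harmonic mean of `K` copies of
`p` and `J - K` copies of `q` so that it also makes sense when `q = ∞`. -/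
noncomputable def bleiExponent (J K : ℕ) (p q : ℝ≥0∞) : ℝ≥0∞ :=
  (((K : ℝ≥0∞) * p⁻¹ + ((J - K : ℕ) : ℝ≥0∞) * q⁻¹) / (J : ℝ≥0∞))⁻¹

namespace BleiAux
open Filter Topology Function

theorem minkowski {A B : Type*} [MeasurableSpace A] [MeasurableSpace B]
    (μ : Measure A) (ν : Measure B) [SigmaFinite μ] [SigmaFinite ν]
    (g : A → B → ℝ≥0∞) (hg : Measurable (uncurry g)) (r : ℝ) (hr : 1 < r) :
    ∫⁻ y, (∫⁻ x, g x y ∂μ) ^ r ∂ν ≤ (∫⁻ x, (∫⁻ y, g x y ^ r ∂ν) ^ (1 / r) ∂μ) ^ r := by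
  have hr0 : 0 < r := by linarith
  set R := ∫⁻ x, (∫⁻ y, g x y ^ r ∂ν) ^ (1 / r) ∂μ with hR
  set G : B → ℝ≥0∞ := fun y => ∫⁻ x, g x y ∂μ with hG
  have hGm : Measurable G := Measurable.lintegral_prod_left hg
  let Gn : ℕ → B → ℝ≥0∞ := fun n => (spanningSets ν n).indicator (fun y => min (G y) n)
  have hGn : ∀ n, Measurable (Gn n) := fun n =>
    (hGm.min measurable_const).indicator (measurableSet_spanningSets ν n)
  have hle : ∀ n y, Gn n y ≤ G y := by
    intro n y
    refine (Set.indicator_le_self _ _ _).trans (min_le_left _ _)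
  have hgy : ∀ y, Measurable fun x => g x y := fun y => hg.of_uncurry_right
  have hgx : ∀ x, Measurable (g x) := fun x => hg.of_uncurry_left
  have hconj : r.HolderConjugate (r / (r - 1)) := Real.HolderConjugate.conjExponent hr
  have hmain : ∀ n, ∫⁻ y, Gn n y ^ r ∂ν ≤ R ^ r := by
    intro n
    set H := ∫⁻ y, Gn n y ^ r ∂ν with hH
    have hfin : H ≠ ∞ := by
      have : H ≤ ∫⁻ y in spanningSets ν n, (n : ℝ≥0∞) ^ r ∂ν := by
        rw [← lintegral_indicator (measurableSet_spanningSets ν n)]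
        refine lintegral_mono fun y => ?_
        by_cases hy : y ∈ spanningSets ν n
        · simp only [Gn, Set.indicator_of_mem hy]
          exact ENNReal.rpow_le_rpow (min_le_right _ _) hr0.le
        · simp [Gn, Set.indicator_of_notMem hy, hr0]
      refine ne_top_of_le_ne_top ?_ this
      rw [setLIntegral_const]
      exact ENNReal.mul_ne_top (ENNReal.rpow_ne_top_of_nonneg hr0.le (by simp))
        (measure_spanningSets_lt_top ν n).ne
    have h1 : H ≤ R * H ^ (1 / (r / (r - 1))) := by
      calc H ≤ ∫⁻ y, ∫⁻ x, g x y * Gn n y ^ (r - 1) ∂μ ∂ν := by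
            refine lintegral_mono fun y => ?_
            rw [lintegral_mul_const _ (hgy y)]
            calc Gn n y ^ r = Gn n y ^ (1 + (r - 1)) := by ring_nf
              _ = Gn n y * Gn n y ^ (r - 1) := by
                rw [ENNReal.rpow_add_of_nonneg _ _ (by norm_num) (by linarith), ENNReal.rpow_one]
              _ ≤ _ := by gcongr; exact hle n y
        _ = ∫⁻ x, ∫⁻ y, g x y * Gn n y ^ (r - 1) ∂ν ∂μ := by
            refine (lintegral_lintegral_swap (Measurable.aemeasurable ?_)).symm
            exact hg.mul (((hGn n).comp measurable_snd).pow_const _)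
        _ ≤ ∫⁻ x, (∫⁻ y, g x y ^ r ∂ν) ^ (1 / r) * H ^ (1 / (r / (r - 1))) ∂μ := by
            refine lintegral_mono fun x => ?_
            have := ENNReal.lintegral_mul_le_Lp_mul_Lq ν hconj (hgx x).aemeasurable
              ((hGn n).pow_const (r - 1)).aemeasurable
            refine this.trans_eq ?_
            congr 3
            ext y
            rw [← ENNReal.rpow_mul]
            congr 1
            have : r - 1 ≠ 0 := by linarith
            field_simp
        _ = _ := by
            rw [lintegral_mul_const]
            exact (Measurable.lintegral_prod_right (f := fun a b => g a b ^ r)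
              (hg.pow_const r)).pow_const _
    by_cases h0 : H = 0
    · rw [h0]; exact zero_le
    have hexp : 1 / r + 1 / (r / (r - 1)) = 1 := by
      have : r - 1 ≠ 0 := by linarith
      field_simp; ring
    have h2 : H ^ (1 / r) ≤ R := by
      have h3 : H ^ (1 / r) * H ^ (1 / (r / (r - 1))) ≤ R * H ^ (1 / (r / (r - 1))) := by
        rw [← ENNReal.rpow_add _ _ h0 hfin, hexp, ENNReal.rpow_one]; exact h1
      refine (ENNReal.mul_le_mul_iff_left ?_ ?_).1 h3
      · exact (ENNReal.rpow_pos (pos_iff_ne_zero.2 h0) hfin).ne'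
      · exact ENNReal.rpow_ne_top_of_nonneg (one_div_nonneg.2 hconj.symm.nonneg) hfin
    calc H = (H ^ (1 / r)) ^ r := by
          rw [← ENNReal.rpow_mul, one_div_mul_cancel hr0.ne', ENNReal.rpow_one]
      _ ≤ R ^ r := ENNReal.rpow_le_rpow h2 hr0.le
  have hlim : ∀ y, Tendsto (fun n => Gn n y ^ r) atTop (𝓝 (G y ^ r)) := by
    intro y
    refine Tendsto.ennrpow_const r ?_
    have h1 : Tendsto (fun n : ℕ => min (G y) (n : ℝ≥0∞)) atTop (𝓝 (min (G y) ∞)) :=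
      tendsto_const_nhds.min ENNReal.tendsto_nat_nhds_top
    rw [min_eq_left le_top] at h1
    refine h1.congr' ?_
    filter_upwards [eventually_ge_atTop (spanningSetsIndex ν y)] with n hn
    have : y ∈ spanningSets ν n := mem_spanningSets_of_index_le ν y hn
    simp [Gn, this]
  calc ∫⁻ y, G y ^ r ∂ν = ∫⁻ y, liminf (fun n => Gn n y ^ r) atTop ∂ν :=
        lintegral_congr fun y => (hlim y).liminf_eq.symm
    _ ≤ liminf (fun n => ∫⁻ y, Gn n y ^ r ∂ν) atTop :=
        lintegral_liminf_le fun n => (hGn n).pow_const r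
    _ ≤ R ^ r := by
        refine liminf_le_of_le (by isBoundedDefault) fun b hb => ?_
        obtain ⟨n, hn⟩ := hb.exists
        exact hn.trans (hmain n)

theorem updateFinset_comm {ι : Type*} [DecidableEq ι] {X : ι → Type*} {s t : Finset ι}
    (hst : Disjoint s t) (x : ∀ i, X i) (a : ∀ i : s, X i) (b : ∀ i : t, X i) :
    updateFinset (updateFinset x s a) t b = updateFinset (updateFinset x t b) s a := by
  ext i
  by_cases h1 : i ∈ s
  · have h2 : i ∉ t := Finset.disjoint_left.1 hst h1
    simp [updateFinset, h1, h2]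
  · simp [updateFinset, h1]

theorem minkowski_marginal {ι : Type*} [DecidableEq ι] {X : ι → Type*}
    [∀ i, MeasurableSpace (X i)] (μ : ∀ i, Measure (X i)) [∀ i, SigmaFinite (μ i)]
    {s t : Finset ι} (hst : Disjoint s t) (g : (∀ i, X i) → ℝ≥0∞) (hg : Measurable g)
    (r : ℝ) (hr : 1 < r) (x : ∀ i, X i) :
    lmarginal μ t (fun y => (lmarginal μ s g y) ^ r) x ≤
      (lmarginal μ s (fun y => (lmarginal μ t (fun z => g z ^ r) y) ^ (1 / r)) x) ^ r := by
  have := minkowski (Measure.pi fun i : s => μ i) (Measure.pi fun i : t => μ i)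
    (fun a b => g (updateFinset (updateFinset x t b) s a)) (by
      refine hg.comp ?_
      have h1 : Measurable fun z : (∀ i : s, X i) × (∀ i : t, X i) =>
        (updateFinset x t z.2, z.1) :=
        (measurable_updateFinset.comp measurable_snd).prodMk measurable_fst
      exact measurable_updateFinset'.comp h1) r hr
  refine this.trans_eq ?_
  simp only [lmarginal]
  congr! 8
  rw [updateFinset_comm hst]

section mixed
variable {ι : Type*} [DecidableEq ι] {X : ι → Type*} [∀ i, MeasurableSpace (X i)]
  (μ : ∀ i, Measure (X i))

/-- one-variable norm of exponent `e` in the variable `j` -/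
noncomputable def T (e : ℝ) (j : ι) (f : (∀ i, X i) → ℝ≥0∞) : (∀ i, X i) → ℝ≥0∞ :=
  fun x => (lmarginal μ {j} (fun y => f y ^ e) x) ^ (1 / e)

/-- iterated norms, the head of the list being the innermost variable -/
noncomputable def M (P : ι → ℝ) : List ι → ((∀ i, X i) → ℝ≥0∞) → (∀ i, X i) → ℝ≥0∞
  | [], f => f
  | j :: L, f => M P L (T μ (P j) j f)

theorem T_mono {e : ℝ} (he : 0 < e) (j : ι) {f g : (∀ i, X i) → ℝ≥0∞} (h : f ≤ g) :
    T μ e j f ≤ T μ e j g := fun x =>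
  ENNReal.rpow_le_rpow (lmarginal_mono (fun y => ENNReal.rpow_le_rpow (h y) he.le) x)
    (one_div_nonneg.2 he.le)

theorem M_mono {P : ι → ℝ} (hP : ∀ j, 0 < P j) (L : List ι) :
    ∀ {f g : (∀ i, X i) → ℝ≥0∞}, f ≤ g → M μ P L f ≤ M μ P L g := by
  induction L with
  | nil => intro f g h; exact h
  | cons j L ih => intro f g h; exact ih (T_mono μ (hP j) j h)

theorem T_meas [∀ i, SigmaFinite (μ i)] (e : ℝ) (j : ι) {f : (∀ i, X i) → ℝ≥0∞}
    (hf : Measurable f) : Measurable (T μ e j f) :=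
  ((hf.pow_const e).lmarginal μ).pow_const _

theorem T_holder [∀ i, SigmaFinite (μ i)] {A : Type*} [Fintype A] (w : ℝ) (hw : 0 ≤ w)
    (r : ℝ) (hr : 0 < r) (P : A → ℝ) (hP : ∀ a, 0 < P a) (hsum : ∑ a, w * r / P a = 1)
    (j : ι) (f : A → (∀ i, X i) → ℝ≥0∞) (hf : ∀ a, Measurable (f a)) (x : ∀ i, X i) :
    T μ r j (fun y => ∏ a, f a y ^ w) x ≤ ∏ a, (T μ (P a) j (f a) x) ^ w := by
  have h := ENNReal.lintegral_prod_norm_pow_le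
    (μ := Measure.pi fun i : ({j} : Finset ι) => μ i) Finset.univ
    (f := fun a y => f a (updateFinset x {j} y) ^ P a)
    (fun a _ => (((hf a).comp measurable_updateFinset).pow_const _).aemeasurable)
    hsum (fun a _ => by have := hP a; positivity)
  have h2 := ENNReal.rpow_le_rpow h (one_div_nonneg.2 hr.le)
  simp only [T, lmarginal]
  convert h2 using 3
  · ext y
    rw [← ENNReal.prod_rpow_of_nonneg hr.le]
    refine Finset.prod_congr rfl fun a _ => ?_
    rw [← ENNReal.rpow_mul, ← ENNReal.rpow_mul]
    congr 1
    have := hP a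
    field_simp
  · rw [← ENNReal.prod_rpow_of_nonneg (one_div_nonneg.2 hr.le)]
    refine Finset.prod_congr rfl fun a _ => ?_
    rw [← ENNReal.rpow_mul, ← ENNReal.rpow_mul]
    congr 1
    have := hP a
    field_simp

theorem M_holder [∀ i, SigmaFinite (μ i)] {A : Type*} [Fintype A] (w : ℝ) (hw : 0 ≤ w)
    (r : ι → ℝ) (hr : ∀ j, 0 < r j) (P : A → ι → ℝ) (hP : ∀ a j, 0 < P a j)
    (hsum : ∀ j, ∑ a, w * r j / P a j = 1) (L : List ι) :
    ∀ (f : A → (∀ i, X i) → ℝ≥0∞), (∀ a, Measurable (f a)) → ∀ (x : ∀ i, X i),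
    M μ r L (fun y => ∏ a, f a y ^ w) x ≤ ∏ a, (M μ (P a) L (f a) x) ^ w := by
  induction L with
  | nil => intro f hf x; exact le_rfl
  | cons j L ih =>
    intro f hf x
    refine (M_mono μ hr L (fun y => T_holder μ w hw (r j) (hr j) (fun a => P a j)
      (fun a => hP a j) (hsum j) j f hf y) x).trans ?_
    exact ih (fun a => T μ (P a j) j (f a)) (fun a => T_meas μ _ j (hf a)) x

theorem M_const [∀ i, SigmaFinite (μ i)] (r : ℝ) (hr : 0 < r) (L : List ι) (hL : L.Nodup) :
    ∀ (f : (∀ i, X i) → ℝ≥0∞), Measurable f → ∀ x,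
    M μ (fun _ => r) L f x = (lmarginal μ L.toFinset (fun y => f y ^ r) x) ^ (1 / r) := by
  induction L with
  | nil =>
    intro f hf x
    simp only [M, List.toFinset_nil, lmarginal_empty]
    rw [← ENNReal.rpow_mul, mul_one_div_cancel hr.ne', ENNReal.rpow_one]
  | cons j L ih =>
    intro f hf x
    rw [List.nodup_cons] at hL
    simp only [M]
    rw [ih hL.2 _ (T_meas μ _ j hf), List.toFinset_cons, Finset.insert_eq,
      lmarginal_union' μ _ (hf.pow_const r) (by simpa using hL.1)]
    congr 2
    ext y
    simp only [T]
    rw [← ENNReal.rpow_mul, one_div_mul_cancel hr.ne', ENNReal.rpow_one]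

theorem M_minkowski [∀ i, SigmaFinite (μ i)] (p q : ℝ) (hp : 0 < p) (hpq : p < q)
    (S : Finset ι) (L : List ι) (hL : L.Nodup) :
    ∀ (f : (∀ i, X i) → ℝ≥0∞), Measurable f → ∀ x,
    M μ (fun j => if j ∈ S then p else q) L f x ≤
      (lmarginal μ (L.toFinset ∩ S) (fun z => (lmarginal μ (L.toFinset \ S)
        (fun y => f y ^ q) z) ^ (p / q)) x) ^ (1 / p) := by
  have hq : 0 < q := hp.trans hpq
  induction L with
  | nil =>
    intro f hf x
    simp only [M, List.toFinset_nil, Finset.empty_inter, Finset.empty_sdiff, lmarginal_empty]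
    rw [← ENNReal.rpow_mul, ← ENNReal.rpow_mul]
    have : q * (p / q * (1 / p)) = 1 := by field_simp
    rw [this, ENNReal.rpow_one]
  | cons j L ih =>
    intro f hf x
    rw [List.nodup_cons] at hL
    have hjL : j ∉ L.toFinset := by simpa using hL.1
    simp only [M]
    refine (ih hL.2 _ (T_meas μ _ j hf) x).trans ?_
    refine ENNReal.rpow_le_rpow ?_ (one_div_nonneg.2 hp.le)
    by_cases hj : j ∈ S
    · have e1 : (j :: L).toFinset ∩ S = {j} ∪ (L.toFinset ∩ S) := by
        rw [List.toFinset_cons, Finset.insert_inter_of_mem hj, Finset.insert_eq]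
      have e2 : (j :: L).toFinset \ S = L.toFinset \ S := by
        rw [List.toFinset_cons, Finset.insert_sdiff_of_mem _ hj]
      rw [e1, e2, lmarginal_union' μ _ (((hf.pow_const q).lmarginal μ).pow_const _)
        (by simp [hL.1])]
      refine lmarginal_mono (fun z => ?_) x
      have h := minkowski_marginal μ (s := {j}) (t := L.toFinset \ S) (by simp [hj])
        (fun y => f y ^ p) (hf.pow_const p) (q / p) ((one_lt_div hp).2 hpq) z
      have h2 := ENNReal.rpow_le_rpow h (div_pos hp hq).le
      have e3 : q / p * (p / q) = 1 := by field_simp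
      have e4 : p * (q / p) = q := by field_simp
      rw [← ENNReal.rpow_mul, e3, ENNReal.rpow_one] at h2
      simp only [← ENNReal.rpow_mul, e4, one_div_div] at h2
      simp only [T, if_pos hj, ← ENNReal.rpow_mul]
      have e5 : 1 / p * q = q / p := by field_simp
      rw [e5]
      exact h2
    · have e1 : (j :: L).toFinset ∩ S = L.toFinset ∩ S := by
        rw [List.toFinset_cons, Finset.insert_inter_of_notMem hj]
      have e2 : (j :: L).toFinset \ S = {j} ∪ (L.toFinset \ S) := by
        rw [List.toFinset_cons, Finset.insert_sdiff_of_notMem _ hj, Finset.insert_eq]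
      rw [e1, e2, lmarginal_union' μ _ (hf.pow_const q) (by simp [hL.1])]
      refine le_of_eq ?_
      congr! 5 with _ y
      simp only [T, if_neg hj]
      rw [← ENNReal.rpow_mul, one_div_mul_cancel hq.ne', ENNReal.rpow_one]

end mixed

theorem count_mem {J K N : ℕ} (hKJ : K < J) (hN : N = J.choose K)
    (S : Fin N → Finset (Fin J)) (hcard : ∀ α, (S α).card = K)
    (henum : ∀ s : Finset (Fin J), s.card = K → ∃! α : Fin N, S α = s) (j : Fin J) :
    J * (Finset.univ.filter fun α => j ∉ S α).card = (J - K) * N := by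
  have h1 : (Finset.univ.filter fun α => j ∉ S α).card =
      (Finset.powersetCard K (Finset.univ.erase j)).card := by
    refine Finset.card_bij (fun α _ => S α) ?_ ?_ ?_
    · intro α hα
      rw [Finset.mem_powersetCard]
      refine ⟨?_, hcard α⟩
      intro i hi
      simp only [Finset.mem_filter, Finset.mem_univ, true_and] at hα
      simp only [Finset.mem_erase, Finset.mem_univ, and_true]
      rintro rfl
      exact hα hi
    · intro a _ b _ hab
      exact (henum (S b) (hcard b)).unique hab rfl
    · intro s hs
      rw [Finset.mem_powersetCard] at hs
      obtain ⟨α, hα, -⟩ := henum s hs.2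
      refine ⟨α, ?_, hα⟩
      simp only [Finset.mem_filter, Finset.mem_univ, true_and, hα]
      intro hj
      simpa using hs.1 hj
  rw [h1, Finset.card_powersetCard, Finset.card_erase_of_mem (Finset.mem_univ j), Finset.card_univ,
    Fintype.card_fin, hN]
  obtain ⟨n, rfl⟩ : ∃ n, J = n + 1 := ⟨J - 1, by omega⟩
  have := Nat.choose_mul_succ_eq n K
  simp only [Nat.add_sub_cancel]
  rw [mul_comm, this, mul_comm]

theorem sum_inv {J K N : ℕ} (hKJ : K < J) (hN : N = J.choose K)
    (S : Fin N → Finset (Fin J)) (hcard : ∀ α, (S α).card = K)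
    (henum : ∀ s : Finset (Fin J), s.card = K → ∃! α : Fin N, S α = s) (j : Fin J) (p q : ℝ) :
    ∑ α, (if j ∈ S α then p else q)⁻¹ = N * ((K * p⁻¹ + (J - K : ℝ) * q⁻¹) / J) := by
  have h := count_mem hKJ hN S hcard henum j
  have h2 := Finset.card_filter_add_card_filter_not (s := (Finset.univ : Finset (Fin N)))
    (fun α => j ∈ S α)
  rw [Finset.card_univ, Fintype.card_fin] at h2
  have hJ : (J : ℝ) ≠ 0 := by
    have : 0 < J := by omega
    positivity
  simp only [apply_ite (fun x : ℝ => x⁻¹)]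
  rw [Finset.sum_ite, Finset.sum_const, Finset.sum_const, nsmul_eq_mul, nsmul_eq_mul]
  set a := (Finset.univ.filter fun α => j ∉ S α).card
  set b := (Finset.univ.filter fun α => j ∈ S α).card
  have h' : (J : ℝ) * a = (J - K) * N := by
    rw [← Nat.cast_sub hKJ.le]; exact_mod_cast h
  have h2' : (b : ℝ) + a = N := by exact_mod_cast h2
  have ha : (a : ℝ) = (J - K) * N / J := by field_simp; linarith
  have hb : (b : ℝ) = K * N / J := by
    rw [eq_sub_of_add_eq h2', ha]; field_simp; ring
  rw [ha, hb]
  field_simp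

/-- the exponent, as a real number -/
noncomputable def rex (J K : ℕ) (p q : ℝ) : ℝ := ((K * p⁻¹ + (J - K : ℝ) * q⁻¹) / J)⁻¹

theorem rex_pos {J K : ℕ} (hK : 0 < K) (hKJ : K < J) {p q : ℝ} (hp : 0 < p) (hq : 0 ≤ q) :
    0 < rex J K p q := by
  have h1 : (0 : ℝ) < J := by exact_mod_cast hK.trans hKJ
  have h2 : (0 : ℝ) < K := by exact_mod_cast hK
  have h3 : (0 : ℝ) < J - K := by
    have : (K : ℝ) < J := by exact_mod_cast hKJ
    linarith
  unfold rex
  positivity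

theorem blei_finite {J K N : ℕ} (hK : 0 < K) (hKJ : K < J) (hN : N = J.choose K)
    (p q : ℝ) (hp : 0 < p) (hpq : p < q)
    (S : Fin N → Finset (Fin J)) (hcard : ∀ α, (S α).card = K)
    (henum : ∀ s : Finset (Fin J), s.card = K → ∃! α : Fin N, S α = s)
    {X : Fin J → Type*} [∀ j, MeasurableSpace (X j)]
    (μ : ∀ j, Measure (X j)) [∀ j, SigmaFinite (μ j)]
    (f : (∀ j, X j) → ℝ≥0∞) (hf : Measurable f) :
    (∫⁻ x, f x ^ (rex J K p q) ∂(Measure.pi μ)) ^ (1 / (rex J K p q)) ≤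
      ∏ α : Fin N,
        (∫⁻ a : ∀ j : S α, X j,
              (∫⁻ b : ∀ j : ((S α)ᶜ : Finset (Fin J)), X j,
                  f (glue (S α) a b) ^ q
                ∂(Measure.pi fun j : ((S α)ᶜ : Finset (Fin J)) => μ j)) ^
                (p / q)
          ∂(Measure.pi fun j : S α => μ j)) ^ (1 / ((N : ℝ) * p)) := by
  have hq : 0 < q := hp.trans hpq
  have hr := rex_pos hK hKJ hp hq.le
  set r := rex J K p q with hrdef
  have hNpos : (0 : ℝ) < N := by rw [hN]; exact_mod_cast Nat.choose_pos hKJ.le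
  rcases isEmpty_or_nonempty (∀ j, X j) with he | ⟨⟨x⟩⟩
  · rw [lintegral_of_isEmpty, ENNReal.zero_rpow_of_pos (by positivity)]
    exact zero_le
  have hL : (List.finRange J).Nodup := List.nodup_finRange J
  have hLu : (List.finRange J).toFinset = Finset.univ := List.toFinset_finRange J
  have h1 := M_const μ r hr _ hL f hf x
  rw [hLu, lmarginal_univ] at h1
  rw [← h1]
  have h2 := M_holder μ (1 / N) (by positivity) (fun _ => r) (fun _ => hr)
    (fun (α : Fin N) j => if j ∈ S α then p else q) (fun α j => by split_ifs <;> assumption)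
    (fun j => by
      have := sum_inv hKJ hN S hcard henum j p q
      simp only [div_eq_mul_inv] at this ⊢
      rw [← Finset.mul_sum, this]
      have e : (K * p⁻¹ + (J - K : ℝ) * q⁻¹) * (J : ℝ)⁻¹ = r⁻¹ := by
        rw [hrdef, rex, inv_inv, div_eq_mul_inv]
      rw [e]
      field_simp) (List.finRange J) (fun _ => f) (fun _ => hf) x
  have e : (fun y => ∏ _α : Fin N, f y ^ (1 / (N : ℝ))) = f := by
    ext y
    rw [Finset.prod_const, Finset.card_univ, Fintype.card_fin, ← ENNReal.rpow_natCast,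
      ← ENNReal.rpow_mul, one_div_mul_cancel hNpos.ne', ENNReal.rpow_one]
  rw [e] at h2
  refine h2.trans ?_
  refine Finset.prod_le_prod' fun α _ => ?_
  have h3 := M_minkowski μ p q hp hpq (S α) _ hL f hf x
  rw [hLu, Finset.univ_inter] at h3
  refine (ENNReal.rpow_le_rpow h3 (one_div_nonneg.2 hNpos.le)).trans_eq ?_
  rw [← ENNReal.rpow_mul]
  have e2 : 1 / p * (1 / (N : ℝ)) = 1 / (N * p) := by field_simp
  rw [e2]
  congr 1
  simp only [lmarginal, ← Finset.compl_eq_univ_sdiff]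
  refine lintegral_congr fun a => ?_
  congr 1
  refine lintegral_congr fun b => ?_
  congr 2
  ext i
  by_cases hi : i ∈ S α <;> simp [updateFinset, glue, hi]

theorem tendsto_const_rpow (a : ℝ≥0∞) {u : ℕ → ℝ} {r : ℝ} (hu : Tendsto u atTop (𝓝 r))
    (h : 0 < r ∨ (a ≠ 0 ∧ a ≠ ∞)) : Tendsto (fun n => a ^ u n) atTop (𝓝 (a ^ r)) := by
  by_cases ha : a ≠ 0 ∧ a ≠ ∞
  · lift a to NNReal using ha.2
    have ha0 : a ≠ 0 := by exact_mod_cast ha.1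
    simp only [← ENNReal.coe_rpow_of_ne_zero ha0]
    exact ENNReal.tendsto_coe.2 (tendsto_const_nhds.nnrpow hu (Or.inl ha0))
  · have hr : 0 < r := h.resolve_right ha
    have hev : ∀ᶠ n in atTop, 0 < u n := hu.eventually (lt_mem_nhds hr)
    refine tendsto_const_nhds.congr' ?_
    filter_upwards [hev] with n hn
    by_cases h0 : a = 0
    · simp [h0, hr, hn]
    · have : a = ∞ := by by_contra h'; exact ha ⟨h0, h'⟩
      simp [this, hr, hn]

theorem blei_top_finite {J K N : ℕ} (hK : 0 < K) (hKJ : K < J) (hN : N = J.choose K)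
    (p : ℝ) (hp : 0 < p)
    (S : Fin N → Finset (Fin J)) (hcard : ∀ α, (S α).card = K)
    (henum : ∀ s : Finset (Fin J), s.card = K → ∃! α : Fin N, S α = s)
    {X : Fin J → Type*} [∀ j, MeasurableSpace (X j)]
    (μ : ∀ j, Measure (X j)) [∀ j, IsFiniteMeasure (μ j)]
    (f : (∀ j, X j) → ℝ≥0∞) (hf : Measurable f) :
    (∫⁻ x, f x ^ (rex J K p 0) ∂(Measure.pi μ)) ≤
      (∏ α : Fin N,
        (∫⁻ a : ∀ j : S α, X j,
              essSup (fun b : ∀ j : ((S α)ᶜ : Finset (Fin J)), X j =>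
                  f (glue (S α) a b))
                (Measure.pi fun j : ((S α)ᶜ : Finset (Fin J)) => μ j) ^ p
          ∂(Measure.pi fun j : S α => μ j)) ^ (1 / ((N : ℝ) * p))) ^ (rex J K p 0) := by
  have hNpos : (0 : ℝ) < N := by rw [hN]; exact_mod_cast Nat.choose_pos hKJ.le
  have hJ : (0 : ℝ) < J := by exact_mod_cast hK.trans hKJ
  have hK' : (0 : ℝ) < K := by exact_mod_cast hK
  set I : Fin N → ℝ≥0∞ := fun α => ∫⁻ a : ∀ j : S α, X j,
              essSup (fun b : ∀ j : ((S α)ᶜ : Finset (Fin J)), X j =>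
                  f (glue (S α) a b))
                (Measure.pi fun j : ((S α)ᶜ : Finset (Fin J)) => μ j) ^ p
          ∂(Measure.pi fun j : S α => μ j) with hI
  set R := ∏ α, I α ^ (1 / ((N : ℝ) * p)) with hR
  let m : Fin N → ℝ≥0∞ := fun α =>
    1 + (Measure.pi fun j : ((S α)ᶜ : Finset (Fin J)) => μ j) Set.univ
  have hm1 : ∀ α, 1 ≤ m α := fun α => le_self_add
  have hmt : ∀ α, m α ≠ ∞ := fun α =>
    ENNReal.add_ne_top.2 ⟨ENNReal.one_ne_top, measure_ne_top _ _⟩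
  let c : ℝ≥0∞ := ∏ α, m α ^ (1 / (N : ℝ))
  have hct : c ≠ ∞ := ENNReal.prod_ne_top fun α _ =>
    ENNReal.rpow_ne_top_of_nonneg (by positivity) (hmt α)
  have hc0 : c ≠ 0 := by
    refine Finset.prod_ne_zero_iff.2 fun α _ => ?_
    refine (ENNReal.rpow_pos (lt_of_lt_of_le one_pos (hm1 α)) (hmt α)).ne'
  let q : ℕ → ℝ := fun n => p + 1 + n
  have hpq : ∀ n, p < q n := fun n => by
    have : (0 : ℝ) ≤ n := Nat.cast_nonneg n
    simp only [q]; linarith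
  have hq : ∀ n, 0 < q n := fun n => hp.trans (hpq n)
  let r : ℕ → ℝ := fun n => rex J K p (q n)
  have hr : ∀ n, 0 < r n := fun n => rex_pos hK hKJ hp (hq n).le
  have hr0 : 0 < rex J K p 0 := rex_pos hK hKJ hp le_rfl
  have hqlim : Tendsto q atTop atTop :=
    tendsto_atTop_add_const_left _ _ tendsto_natCast_atTop_atTop
  have hqinv : Tendsto (fun n => (q n)⁻¹) atTop (𝓝 0) := tendsto_inv_atTop_zero.comp hqlim
  have hrlim : Tendsto r atTop (𝓝 (rex J K p 0)) := by
    simp only [r, rex, inv_zero]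
    refine Tendsto.inv₀ ?_ (by rw [mul_zero, add_zero]; positivity)
    exact ((hqinv.const_mul _).const_add _).div_const _
  have hstep : ∀ n, ∫⁻ x, f x ^ r n ∂(Measure.pi μ) ≤ R ^ r n * c ^ (r n * (q n)⁻¹) := by
    intro n
    have h := blei_finite hK hKJ hN p (q n) hp (hpq n) S hcard henum μ f hf
    have h2 : (∫⁻ x, f x ^ r n ∂(Measure.pi μ)) ^ (1 / r n) ≤ R * c ^ (q n)⁻¹ := by
      refine h.trans ?_
      have e : R * c ^ (q n)⁻¹ = ∏ α, (I α * m α ^ (p / q n)) ^ (1 / ((N : ℝ) * p)) := by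
        simp only [hR, c]
        rw [← ENNReal.prod_rpow_of_nonneg (inv_nonneg.2 (hq n).le), ← Finset.prod_mul_distrib]
        refine Finset.prod_congr rfl fun α _ => ?_
        rw [ENNReal.mul_rpow_of_nonneg _ _ (by positivity), ← ENNReal.rpow_mul,
          ← ENNReal.rpow_mul]
        congr 2
        have := hq n
        field_simp
      rw [e]
      refine Finset.prod_le_prod' fun α _ => ENNReal.rpow_le_rpow ?_ (by positivity)
      rw [hI, ← lintegral_mul_const' _ _ (ENNReal.rpow_ne_top_of_nonneg
        (div_pos hp (hq n)).le (hmt α))]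
      refine lintegral_mono fun a => ?_
      set E := essSup (fun b : ∀ j : ((S α)ᶜ : Finset (Fin J)), X j => f (glue (S α) a b))
                (Measure.pi fun j : ((S α)ᶜ : Finset (Fin J)) => μ j) with hE
      have h3 : ∫⁻ b : ∀ j : ((S α)ᶜ : Finset (Fin J)), X j, f (glue (S α) a b) ^ q n
          ∂(Measure.pi fun j : ((S α)ᶜ : Finset (Fin J)) => μ j) ≤ E ^ q n * m α := by
        calc _ ≤ ∫⁻ _b : ∀ j : ((S α)ᶜ : Finset (Fin J)), X j, E ^ q n
              ∂(Measure.pi fun j : ((S α)ᶜ : Finset (Fin J)) => μ j) := by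
              refine lintegral_mono_ae ?_
              filter_upwards [ENNReal.ae_le_essSup
                (μ := Measure.pi fun j : ((S α)ᶜ : Finset (Fin J)) => μ j)
                (fun b => f (glue (S α) a b))] with b hb
              exact ENNReal.rpow_le_rpow hb (hq n).le
          _ = E ^ q n * (Measure.pi fun j : ((S α)ᶜ : Finset (Fin J)) => μ j) Set.univ := by
              rw [lintegral_const]
          _ ≤ _ := by gcongr; exact le_add_self
      refine (ENNReal.rpow_le_rpow h3 (div_pos hp (hq n)).le).trans_eq ?_
      rw [ENNReal.mul_rpow_of_nonneg _ _ (div_pos hp (hq n)).le, ← ENNReal.rpow_mul,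
        mul_div_cancel₀ _ (hq n).ne']
    have h4 := ENNReal.rpow_le_rpow h2 (hr n).le
    rwa [← ENNReal.rpow_mul, one_div_mul_cancel (hr n).ne', ENNReal.rpow_one,
      ENNReal.mul_rpow_of_nonneg _ _ (hr n).le, ← ENNReal.rpow_mul, mul_comm (q n)⁻¹] at h4
  have hlimR : Tendsto (fun n => R ^ r n * c ^ (r n * (q n)⁻¹)) atTop
      (𝓝 (R ^ rex J K p 0)) := by
    have h1 := tendsto_const_rpow R hrlim (Or.inl hr0)
    have h2 := tendsto_const_rpow c (hrlim.mul hqinv) (Or.inr ⟨hc0, hct⟩)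
    rw [mul_zero, ENNReal.rpow_zero] at h2
    have := ENNReal.Tendsto.mul h1 (Or.inr ENNReal.one_ne_top) h2 (Or.inl one_ne_zero)
    rwa [mul_one] at this
  calc ∫⁻ x, f x ^ rex J K p 0 ∂(Measure.pi μ)
      = ∫⁻ x, liminf (fun n => f x ^ r n) atTop ∂(Measure.pi μ) :=
        lintegral_congr fun x => (tendsto_const_rpow (f x) hrlim (Or.inl hr0)).liminf_eq.symm
    _ ≤ liminf (fun n => ∫⁻ x, f x ^ r n ∂(Measure.pi μ)) atTop :=
        lintegral_liminf_le fun n => hf.pow_const _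
    _ ≤ liminf (fun n => R ^ r n * c ^ (r n * (q n)⁻¹)) atTop :=
        liminf_le_liminf (Eventually.of_forall hstep)
    _ = _ := hlimR.liminf_eq

theorem blei_top {J K N : ℕ} (hK : 0 < K) (hKJ : K < J) (hN : N = J.choose K)
    (p : ℝ) (hp : 0 < p)
    (S : Fin N → Finset (Fin J)) (hcard : ∀ α, (S α).card = K)
    (henum : ∀ s : Finset (Fin J), s.card = K → ∃! α : Fin N, S α = s)
    {X : Fin J → Type*} [∀ j, MeasurableSpace (X j)]
    (μ : ∀ j, Measure (X j)) [∀ j, SigmaFinite (μ j)]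
    (f : (∀ j, X j) → ℝ≥0∞) (hf : Measurable f) :
    (∫⁻ x, f x ^ (rex J K p 0) ∂(Measure.pi μ)) ^ (1 / rex J K p 0) ≤
      (∏ α : Fin N,
        (∫⁻ a : ∀ j : S α, X j,
              essSup (fun b : ∀ j : ((S α)ᶜ : Finset (Fin J)), X j =>
                  f (glue (S α) a b))
                (Measure.pi fun j : ((S α)ᶜ : Finset (Fin J)) => μ j) ^ p
          ∂(Measure.pi fun j : S α => μ j)) ^ (1 / ((N : ℝ) * p))) := by
  have hr0 : 0 < rex J K p 0 := rex_pos hK hKJ hp le_rfl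
  rw [one_div, ENNReal.rpow_inv_le_iff hr0]
  let A : ℕ → Set (∀ j, X j) := fun n => Set.univ.pi fun j => spanningSets (μ j) n
  have hA : Monotone A := fun a b hab => Set.pi_mono fun j _ => monotone_spanningSets (μ j) hab
  have hU : ⋃ n, A n = Set.univ := by
    refine Set.eq_univ_of_forall fun x => Set.mem_iUnion.2
      ⟨Finset.univ.sup fun j => spanningSetsIndex (μ j) (x j), fun j _ => ?_⟩
    exact mem_spanningSets_of_index_le (μ j) (x j)
      (Finset.le_sup (f := fun j => spanningSetsIndex (μ j) (x j)) (Finset.mem_univ j))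
  rw [← setLIntegral_univ, ← hU, setLIntegral_iUnion_of_directed _ hA.directed_le]
  refine iSup_le fun n => ?_
  rw [Measure.restrict_pi_pi]
  haveI : ∀ j, IsFiniteMeasure ((μ j).restrict (spanningSets (μ j) n)) := fun j =>
    isFiniteMeasure_restrict.2 (measure_spanningSets_lt_top (μ j) n).ne
  refine (blei_top_finite hK hKJ hN p hp S hcard henum
    (fun j => (μ j).restrict (spanningSets (μ j) n)) f hf).trans ?_
  refine ENNReal.rpow_le_rpow ?_ hr0.le
  refine Finset.prod_le_prod' fun α _ => ENNReal.rpow_le_rpow ?_ (by positivity)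
  have hle : ∀ s : Finset (Fin J), (Measure.pi fun j : s => (μ j).restrict (spanningSets (μ j) n))
      ≤ Measure.pi fun j : s => μ j := fun s => by
    rw [← Measure.restrict_pi_pi (fun j : s => μ j) (fun j : s => spanningSets (μ j) n)]
    exact Measure.restrict_le_self
  refine lintegral_mono' (hle _) fun a => ENNReal.rpow_le_rpow ?_ hp.le
  exact essSup_mono_measure' (hle _)

theorem exponent_toReal {J K : ℕ} (hKJ : K < J) (p q : ℝ≥0∞) (hp : p ≠ 0) (hq : q ≠ 0) :
    (bleiExponent J K p q).toReal = rex J K p.toReal q.toReal := by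
  unfold bleiExponent rex
  rw [ENNReal.toReal_inv, ENNReal.toReal_div, ENNReal.toReal_add, ENNReal.toReal_mul,
    ENNReal.toReal_mul, ENNReal.toReal_inv, ENNReal.toReal_inv, ENNReal.toReal_natCast,
    ENNReal.toReal_natCast, ENNReal.toReal_natCast, Nat.cast_sub hKJ.le]
  · exact ENNReal.mul_ne_top (by simp) (by simpa using hp)
  · exact ENNReal.mul_ne_top (by simp) (by simpa using hq)

end BleiAux

/-- Generalized Blei inequality with exponents `p` and `q`, `0 < p < q ≤ ∞`: with
`S₁, …, S_N` enumerating the `K`-element subsets of `{1, …, J}` (`N = C(J,K)`),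
`‖f‖_{Jpq/(pJ+(q−p)K)} ≤ ∏_α [∫_{S_α} (∫_{∼S_α} |f|^q)^{p/q}]^{1/(Np)}`,
where `∫_E` denotes integration over `∏_{k ∈ E} X_k` with the product measure, and
for `q = ∞` the inner factor is the essential supremum in the variables of `∼S_α`,
raised to the power `p`. -/
theorem blei_p_q {J K N : ℕ} (hK : 0 < K) (hKJ : K < J) (hN : N = J.choose K)
    (p q : ℝ≥0∞) (hp : 0 < p) (hpq : p < q)
    (S : Fin N → Finset (Fin J)) (hcard : ∀ α, (S α).card = K)
    (henum : ∀ s : Finset (Fin J), s.card = K → ∃! α : Fin N, S α = s)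
    {X : Fin J → Type*} [∀ j, MeasurableSpace (X j)]
    (μ : ∀ j, Measure (X j)) [∀ j, SigmaFinite (μ j)]
    (f : (∀ j, X j) → ℝ≥0∞) (hf : Measurable f) :
    (∫⁻ x, f x ^ (bleiExponent J K p q).toReal ∂(Measure.pi μ)) ^
        (1 / (bleiExponent J K p q).toReal) ≤
      ∏ α : Fin N,
        (∫⁻ a : ∀ j : S α, X j,
            (if q = ∞ then
              essSup (fun b : ∀ j : ((S α)ᶜ : Finset (Fin J)), X j =>
                  f (glue (S α) a b))
                (Measure.pi fun j : ((S α)ᶜ : Finset (Fin J)) => μ j) ^ p.toReal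
            else
              (∫⁻ b : ∀ j : ((S α)ᶜ : Finset (Fin J)), X j,
                  f (glue (S α) a b) ^ q.toReal
                ∂(Measure.pi fun j : ((S α)ᶜ : Finset (Fin J)) => μ j)) ^
                (p.toReal / q.toReal))
          ∂(Measure.pi fun j : S α => μ j)) ^ (1 / ((N : ℝ) * p.toReal)) := by
  have hp0 : 0 < p.toReal := ENNReal.toReal_pos hp.ne' (ne_top_of_lt hpq)
  rw [BleiAux.exponent_toReal hKJ p q hp.ne' (hp.trans hpq).ne']
  by_cases hq : q = ∞
  · simp only [if_pos hq]
    rw [hq, ENNReal.toReal_top]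
    exact BleiAux.blei_top hK hKJ hN p.toReal hp0 S hcard henum μ f hf
  · simp only [if_neg hq]
    exact BleiAux.blei_finite hK hKJ hN p.toReal q.toReal hp0
      ((ENNReal.toReal_lt_toReal (ne_top_of_lt hpq) hq).2 hpq) S hcard henum μ f hf
end

section
/- Popa–Sinnamon inequality, second form: let n ≥ 2 and let q₁,…,qₙ be positive, possibly infinite, exponents with Σ_{j=1}^n 1/qⱼ ≤ 1. Define sⱼ by 1/sⱼ = 1/qⱼ + (1/(n−1))(1 − Σ_{k=1}^n 1/q_k). Then for any σ-finite measure spaces (M₁,μ₁),…,(Mₙ,μₙ) and any nonnegative measurable functions f₁,…,fₙ on the product Mⁿ = ∏_{k=1}^n M_k, ∫_{Mⁿ} f₁⋯fₙ dμⁿ ≤ ∏_{j=1}^n ( ∫_{Mⁿⱼ} ( ∫_{M_j} fⱼ^{qⱼ} dμⱼ )^{sⱼ/qⱼ} dμⁿⱼ )^{1/sⱼ}, where Mⁿⱼ = ∏_{k≠j} M_k with measure μⁿⱼ = ∏_{k≠j} μ_k. -/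
open MeasureTheory
open scoped ENNReal

/-- Combine a point `t` of `M j` and a point of `∏_{k ≠ j} M k` into a point of the
full product `∏ k, M k`. -/
def glueAt {n : ℕ} {M : Fin n → Type*} (j : Fin n) (t : M j)
    (y : ∀ k : {k : Fin n // k ≠ j}, M k) : ∀ k, M k :=
  fun k => if h : k = j then cast (congrArg M h.symm) t else y ⟨k, h⟩

section PS
variable {n : ℕ} {M : Fin n → Type*} [∀ k, MeasurableSpace (M k)]

/-- Restriction to the coordinates other than `j`. -/
def psRes (j : Fin n) (x : ∀ k, M k) : ∀ k : {k : Fin n // k ≠ j}, M k := fun k => x k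

theorem psRes_glue (j : Fin n) (t : M j) (y : ∀ k : {k : Fin n // k ≠ j}, M k) :
    psRes j (glueAt j t y) = y := by
  funext k
  simp [psRes, glueAt, k.2]

theorem glue_psRes (j : Fin n) (t : M j) (x : ∀ k, M k) :
    glueAt j t (psRes j x) = Function.update x j t := by
  funext k
  by_cases h : k = j
  · subst h; simp [glueAt]
  · simp [glueAt, h, psRes]

theorem measurable_psRes (j : Fin n) : Measurable (psRes (M := M) j) :=
  measurable_pi_iff.mpr fun _ => measurable_pi_apply _

theorem measurable_glue (j : Fin n) :
    Measurable (fun p : M j × (∀ k : {k : Fin n // k ≠ j}, M k) => glueAt j p.1 p.2) := by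
  refine measurable_pi_iff.mpr fun k => ?_
  by_cases h : k = j
  · subst h; simpa [glueAt] using measurable_fst
  · simp only [glueAt, h, dite_false]
    exact (measurable_pi_apply _).comp measurable_snd

variable (μ : ∀ k, Measure (M k)) [∀ k, SigmaFinite (μ k)]

theorem lmarginal_res (j : Fin n) (h : (∀ k : {k : Fin n // k ≠ j}, M k) → ℝ≥0∞)
    (hh : Measurable h) (x : ∀ k, M k) :
    lmarginal μ (Finset.univ.erase j) (fun x => h (psRes j x)) x =
      ∫⁻ y, h y ∂(Measure.pi fun k : {k : Fin n // k ≠ j} => μ k) := by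
  have := lmarginal_image (μ := μ) (e := fun k : {k : Fin n // k ≠ j} => (k : Fin n))
    Subtype.val_injective Finset.univ hh x
  have h2 : (Finset.univ.image fun k : {k : Fin n // k ≠ j} => (k : Fin n))
      = Finset.univ.erase j := by
    ext k; simp
  rw [h2, lmarginal_univ] at this
  exact this

theorem lintegral_glue (j : Fin n) (g : (∀ k, M k) → ℝ≥0∞) (hg : Measurable g) :
    ∫⁻ x, g x ∂(Measure.pi μ) =
      ∫⁻ y, ∫⁻ t, g (glueAt j t y) ∂(μ j)
        ∂(Measure.pi fun k : {k : Fin n // k ≠ j} => μ k) := by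
  rcases isEmpty_or_nonempty (∀ k, M k) with he | ⟨⟨x⟩⟩
  · have : ∀ t y, g (glueAt j t y) = 0 := fun t y => he.elim (glueAt j t y)
    simp [this]
  · rw [lintegral_eq_lmarginal_univ x, lmarginal_erase' g hg (Finset.mem_univ j),
      ← lmarginal_res μ j _ _ x]
    · simp only [glue_psRes]
    · exact Measurable.lintegral_prod_left' (hg.comp (measurable_glue j))

theorem ae_glue (j : Fin n) (p : (∀ k, M k) → Prop) (hp : MeasurableSet {x | p x})
    (h : ∀ᵐ y ∂(Measure.pi fun k : {k : Fin n // k ≠ j} => μ k),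
      ∀ᵐ t ∂(μ j), p (glueAt j t y)) : ∀ᵐ x ∂(Measure.pi μ), p x := by
  rw [ae_iff]
  have hm : MeasurableSet {x | ¬ p x} := hp.compl
  rw [← lintegral_indicator_one hm, lintegral_glue μ j _ (measurable_one.indicator hm)]
  refine lintegral_eq_zero_of_ae_eq_zero ?_
  filter_upwards [h] with y hy
  refine lintegral_eq_zero_of_ae_eq_zero ?_
  filter_upwards [hy] with t ht
  simp [ht]

theorem loomis_whitney_marginal (hn : 2 ≤ n) (G : Fin n → (∀ k, M k) → ℝ≥0∞)
    (hG : ∀ j, Measurable (G j)) (s : Finset (Fin n)) (x : ∀ k, M k) :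
    (∀ j, ∀ x t, G j (Function.update x j t) = G j x) →
    lmarginal μ s (fun x => ∏ j, G j x ^ (1 / ((n : ℝ) - 1))) x ≤
      ∏ j, (lmarginal μ (s.erase j) (G j) x) ^ (1 / ((n : ℝ) - 1)) := by
  intro hind
  have hn' : (0 : ℝ) < (n : ℝ) - 1 := by
    have : (2 : ℝ) ≤ n := by exact_mod_cast hn
    linarith
  have hmeas : Measurable (fun x => ∏ j, G j x ^ (1 / ((n : ℝ) - 1))) :=
    Finset.measurable_fun_prod _ fun j _ => (hG j).pow_const _
  induction s using Finset.induction generalizing x with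
  | empty => simp
  | insert i s hi ih =>
    rw [lmarginal_insert _ hmeas hi]
    have hme : ∀ j, Measurable fun t => lmarginal μ (s.erase j) (G j) (Function.update x i t) :=
      fun j => ((hG j).lmarginal μ).comp (measurable_update x)
    calc _ ≤ ∫⁻ t, ∏ j, (lmarginal μ (s.erase j) (G j) (Function.update x i t))
              ^ (1 / ((n : ℝ) - 1)) ∂(μ i) := lintegral_mono fun t => ih _
      _ = ∫⁻ t, (lmarginal μ s (G i) x) ^ (1 / ((n : ℝ) - 1)) *
            ∏ j ∈ Finset.univ.erase i, (lmarginal μ (s.erase j) (G j) (Function.update x i t))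
              ^ (1 / ((n : ℝ) - 1)) ∂(μ i) := by
          refine lintegral_congr fun t => ?_
          rw [← Finset.mul_prod_erase _ _ (Finset.mem_univ i), Finset.erase_eq_of_notMem hi,
            lmarginal_update_of_notMem (hG i) hi]
          congr 3
          funext z
          exact hind i z t
      _ = (lmarginal μ s (G i) x) ^ (1 / ((n : ℝ) - 1)) *
          ∫⁻ t, ∏ j ∈ Finset.univ.erase i,
            (lmarginal μ (s.erase j) (G j) (Function.update x i t))
              ^ (1 / ((n : ℝ) - 1)) ∂(μ i) := by
          rw [lintegral_const_mul]
          exact Finset.measurable_fun_prod _ fun j _ => (hme j).pow_const _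
      _ ≤ (lmarginal μ s (G i) x) ^ (1 / ((n : ℝ) - 1)) *
          ∏ j ∈ Finset.univ.erase i,
            (∫⁻ t, lmarginal μ (s.erase j) (G j) (Function.update x i t) ∂(μ i))
              ^ (1 / ((n : ℝ) - 1)) := by
          gcongr
          refine ENNReal.lintegral_prod_norm_pow_le _ (fun j _ => (hme j).aemeasurable) ?_
            fun j _ => by positivity
          rw [Finset.sum_const, Finset.card_erase_of_mem (Finset.mem_univ i), Finset.card_univ,
            Fintype.card_fin, nsmul_eq_mul, Nat.cast_sub (by omega)]
          field_simp
          simp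
      _ = _ := by
          rw [← Finset.mul_prod_erase Finset.univ _ (Finset.mem_univ i), Finset.erase_insert hi]
          congr 1
          refine Finset.prod_congr rfl fun j hj => ?_
          have hij : i ≠ j := (Finset.ne_of_mem_erase hj).symm
          rw [Finset.erase_insert_of_ne hij, lmarginal_insert _ (hG j) (by simp [hi])]

theorem loomis_whitney (hn : 2 ≤ n) (H : ∀ j : Fin n, (∀ k : {k : Fin n // k ≠ j}, M k) → ℝ≥0∞)
    (hH : ∀ j, Measurable (H j)) :
    ∫⁻ x, ∏ j, H j (psRes j x) ^ (1 / ((n : ℝ) - 1)) ∂(Measure.pi μ) ≤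
      ∏ j, (∫⁻ y, H j y ∂(Measure.pi fun k : {k : Fin n // k ≠ j} => μ k))
        ^ (1 / ((n : ℝ) - 1)) := by
  rcases isEmpty_or_nonempty (∀ k, M k) with he | ⟨⟨x⟩⟩
  · simp
  · rw [lintegral_eq_lmarginal_univ x]
    refine (loomis_whitney_marginal μ hn (fun j x => H j (psRes j x))
      (fun j => (hH j).comp (measurable_psRes j)) Finset.univ x ?_).trans_eq ?_
    · intro j x t
      rw [← glue_psRes, psRes_glue]
    · exact Finset.prod_congr rfl fun j _ => by rw [lmarginal_res μ j _ (hH j)]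

end PS

section EN
variable {α : Type*} [MeasurableSpace α]

theorem eNorm_zero_ae (μ : Measure α) (p : ℝ≥0∞) (hp : p ≠ 0) (g : α → ℝ≥0∞) (hg : Measurable g)
    (h : eNorm μ p g = 0) : ∀ᵐ x ∂μ, g x = 0 := by
  unfold eNorm at h
  split_ifs at h with hi
  · exact ENNReal.essSup_eq_zero_iff.mp h
  · have hp0 : 0 < p.toReal := ENNReal.toReal_pos hp hi
    rw [ENNReal.rpow_eq_zero_iff_of_pos (by positivity),
      lintegral_eq_zero_iff (hg.pow_const _)] at h
    filter_upwards [h] with x hx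
    exact (ENNReal.rpow_eq_zero_iff_of_pos hp0).mp hx

theorem eNorm_top_ae (μ : Measure α) (p : ℝ≥0∞) (hp : p ≠ 0) (g : α → ℝ≥0∞) (hg : Measurable g)
    (h : eNorm μ p g ≠ ∞) : ∀ᵐ x ∂μ, g x ≠ ∞ := by
  unfold eNorm at h
  split_ifs at h with hi
  · filter_upwards [ENNReal.ae_le_essSup (μ := μ) g] with x hx
    exact (hx.trans_lt h.lt_top).ne
  · have hp0 : 0 < p.toReal := ENNReal.toReal_pos hp hi
    have h' : ∫⁻ a, g a ^ p.toReal ∂μ ≠ ∞ := by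
      intro h'
      rw [h', ENNReal.top_rpow_of_pos (by positivity)] at h
      exact h rfl
    filter_upwards [ae_lt_top (hg.pow_const _) h'] with x hx hx'
    rw [hx', ENNReal.top_rpow_of_pos hp0] at hx
    exact lt_irrefl _ hx

theorem measurable_eNorm {β : Type*} [MeasurableSpace β] (μ : Measure α) [SFinite μ] (p : ℝ≥0∞)
    (g : α × β → ℝ≥0∞) (hg : Measurable g) :
    Measurable fun y => eNorm μ p (fun t => g (t, y)) := by
  unfold eNorm
  split_ifs with hi
  · refine measurable_of_Iic fun c => ?_
    have : (fun y => essSup (fun t => g (t, y)) μ) ⁻¹' Set.Iic c =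
        {y | μ ((fun t => (t, y)) ⁻¹' {z | c < g z}) = 0} := by
      ext y
      simp only [Set.mem_preimage, Set.mem_Iic, Set.mem_ofPred_eq]
      constructor
      · intro h
        have := ENNReal.ae_le_essSup (μ := μ) (fun t => g (t, y))
        have h2 : ∀ᵐ t ∂μ, g (t, y) ≤ c := this.mono fun t ht => ht.trans h
        rw [ae_iff] at h2
        simpa using h2
      · intro h
        refine essSup_le_of_ae_le c ?_
        change ∀ᵐ t ∂μ, g (t, y) ≤ c
        rw [ae_iff]
        simpa using h
    rw [this]
    exact measurable_measure_prodMk_right (measurableSet_lt measurable_const hg)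
      (measurableSet_singleton 0)
  · exact (Measurable.lintegral_prod_left' (hg.pow_const _)).pow_const _
end EN

theorem rpow_split_le (x : ℝ≥0∞) (p r : ℝ) (hp : 0 < p) (hr : 0 < r) :
    x ^ p * x ^ (r - p) ≤ x ^ r := by
  rcases eq_or_ne x 0 with rfl | h0
  · simp [ENNReal.zero_rpow_of_pos hp]
  rcases eq_or_ne x ∞ with rfl | h1
  · simp [ENNReal.top_rpow_of_pos hr]
  rw [← ENNReal.rpow_add _ _ h0 h1]
  simp

section KEY
variable {n : ℕ} {M : Fin n → Type*} [∀ k, MeasurableSpace (M k)]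
variable (μ : ∀ k, Measure (M k)) [∀ k, SigmaFinite (μ k)]

theorem key_factor (j : Fin n) (q β : ℝ≥0∞) (hq : 0 < q) (hβ : β ≠ ∞)
    (f : (∀ k, M k) → ℝ≥0∞) (hf : Measurable f)
    (hN : eNorm (Measure.pi fun k : {k : Fin n // k ≠ j} => μ k) (q⁻¹ + β)⁻¹
          (fun y => eNorm (μ j) q (fun t => f (glueAt j t y))) ≠ ∞) :
    ∃ (K D : ℝ≥0∞) (G : (∀ k, M k) → ℝ≥0∞) (H : (∀ k : {k : Fin n // k ≠ j}, M k) → ℝ≥0∞),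
      Measurable G ∧ Measurable H ∧
      (∀ᵐ x ∂(Measure.pi μ), f x ≤ K * G x ^ (q⁻¹).toReal * H (psRes j x) ^ β.toReal) ∧
      ∫⁻ x, G x ∂(Measure.pi μ) ≤ D ∧
      ∫⁻ y, H y ∂(Measure.pi fun k : {k : Fin n // k ≠ j} => μ k) ≤ D ∧
      K * D ^ ((q⁻¹).toReal + β.toReal) =
        eNorm (Measure.pi fun k : {k : Fin n // k ≠ j} => μ k) (q⁻¹ + β)⁻¹
          (fun y => eNorm (μ j) q (fun t => f (glueAt j t y))) := by
  set F : (∀ k : {k : Fin n // k ≠ j}, M k) → ℝ≥0∞ :=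
    fun y => eNorm (μ j) q (fun t => f (glueAt j t y)) with hF
  have hFm : Measurable F :=
    measurable_eNorm (μ j) q (fun p => f (glueAt j p.1 p.2)) (hf.comp (measurable_glue j))
  have hFr : Measurable fun x => F (psRes j x) := hFm.comp (measurable_psRes j)
  have hqi : q⁻¹ ≠ ∞ := ENNReal.inv_ne_top.mpr hq.ne'
  have hs0 : (q⁻¹ + β)⁻¹ ≠ 0 := ENNReal.inv_ne_zero.mpr (ENNReal.add_ne_top.mpr ⟨hqi, hβ⟩)
  have hsec : ∀ y, Measurable fun t => f (glueAt j t y) := fun y =>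
    hf.comp ((measurable_glue j).comp (measurable_id.prodMk measurable_const))
  rcases eq_or_ne q ∞ with hq' | hq'
  · skip
    have hle : ∀ᵐ x ∂(Measure.pi μ), f x ≤ F (psRes j x) := by
      refine ae_glue μ j _ (measurableSet_le hf hFr) (ae_of_all _ fun y => ?_)
      simp only [psRes_glue, hF, eNorm, hq', if_true]
      exact ENNReal.ae_le_essSup _
    rcases eq_or_ne β 0 with hb | hb
    · refine ⟨eNorm (Measure.pi fun k : {k : Fin n // k ≠ j} => μ k) (q⁻¹ + β)⁻¹ F, 0, 0, 0,
        measurable_const, measurable_const, ?_, by simp, by simp, by simp [hq', hb]⟩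
      have h2 : ∀ᵐ x ∂(Measure.pi μ), F (psRes j x) ≤
          eNorm (Measure.pi fun k : {k : Fin n // k ≠ j} => μ k) (q⁻¹ + β)⁻¹ F := by
        refine ae_glue μ j _ (measurableSet_le hFr measurable_const) ?_
        have := ENNReal.ae_le_essSup (μ := Measure.pi fun k : {k : Fin n // k ≠ j} => μ k) F
        filter_upwards [this] with y hy
        refine ae_of_all _ fun t => ?_
        rw [psRes_glue]
        simpa [eNorm, hq', hb] using hy
      filter_upwards [hle, h2] with x h1 h2
      simpa [hq', hb] using h1.trans h2
    · have hb0 : 0 < β.toReal := ENNReal.toReal_pos hb hβ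
      refine ⟨1, ∫⁻ y, F y ^ (1 / β.toReal)
          ∂(Measure.pi fun k : {k : Fin n // k ≠ j} => μ k), 0, fun y => F y ^ (1 / β.toReal),
        measurable_const, hFm.pow_const _, ?_, by simp, le_rfl, ?_⟩
      · filter_upwards [hle] with x h1
        rw [← ENNReal.rpow_mul, one_div_mul_cancel hb0.ne']
        simpa [hq'] using h1
      · simp [eNorm, hq', hb]
  · skip
    have hp : 0 < q.toReal := ENNReal.toReal_pos hq.ne' hq'
    have hb0 : 0 ≤ β.toReal := ENNReal.toReal_nonneg
    have ha : (q⁻¹).toReal = 1 / q.toReal := by rw [ENNReal.toReal_inv, one_div]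
    have ha0 : 0 < (q⁻¹).toReal := by rw [ha]; positivity
    set p := q.toReal with hpdef
    set a := (q⁻¹).toReal with hadef
    set b := β.toReal with hbdef
    set r : ℝ := 1 / (a + b) with hr
    have hr0 : 0 < r := by positivity
    have hs1 : (q⁻¹ + β)⁻¹ ≠ ∞ := by
      rw [ENNReal.inv_ne_top]
      simp [hq']
    have hsr : ((q⁻¹ + β)⁻¹).toReal = r := by
      rw [ENNReal.toReal_inv, ENNReal.toReal_add hqi hβ, hr, one_div]
    have hFeq : ∀ y, ∫⁻ t, f (glueAt j t y) ^ p ∂(μ j) = F y ^ p := by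
      intro y
      simp only [hF, eNorm, hq', if_false]
      rw [← ENNReal.rpow_mul, ← hpdef, one_div_mul_cancel hp.ne', ENNReal.rpow_one]
    have hFtop := eNorm_top_ae _ _ hs0 F hFm hN
    refine ⟨1, ∫⁻ y, F y ^ r ∂(Measure.pi fun k : {k : Fin n // k ≠ j} => μ k),
      fun x => f x ^ p * F (psRes j x) ^ (r - p), fun y => F y ^ r,
      (hf.pow_const _).mul (hFr.pow_const _), hFm.pow_const _, ?_, ?_, le_rfl, ?_⟩
    · have h1 : ∀ᵐ x ∂(Measure.pi μ), F (psRes j x) ≠ ∞ := by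
        refine ae_glue μ j _ (hFr (measurableSet_singleton ∞).compl) ?_
        filter_upwards [hFtop] with y hy
        exact ae_of_all _ fun t => by rwa [psRes_glue]
      have h2 : ∀ᵐ x ∂(Measure.pi μ), F (psRes j x) = 0 → f x = 0 := by
        refine ae_glue μ j _ ?_ (ae_of_all _ fun y => ?_)
        · exact ((hFr (measurableSet_singleton 0)).imp (hf (measurableSet_singleton 0)))
        · simp only [psRes_glue]
          by_cases h0 : F y = 0
          · filter_upwards [eNorm_zero_ae _ q hq.ne' _ (hsec y) h0] with t ht _
            exact ht
          · exact ae_of_all _ fun t h => absurd h h0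
      filter_upwards [h1, h2] with x h1 h2
      by_cases h0 : F (psRes j x) = 0
      · simp [h2 h0]
      · rw [one_mul, ENNReal.mul_rpow_of_nonneg _ _ ha0.le, ← ENNReal.rpow_mul,
          ← ENNReal.rpow_mul, ← ENNReal.rpow_mul, mul_assoc, ← ENNReal.rpow_add _ _ h0 h1]
        have e1 : p * a = 1 := by rw [ha]; field_simp
        have e2 : r * (a + b) = 1 := by rw [hr]; field_simp
        have e3 : (r - p) * a + r * b = 0 := by linarith
        simp [e1, e3]
    · rw [lintegral_glue μ j (fun x => f x ^ p * F (psRes j x) ^ (r - p)) ((hf.pow_const _).mul (hFr.pow_const _))]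
      refine lintegral_mono fun y => ?_
      simp only [psRes_glue]
      rw [lintegral_mul_const _ ((hsec y).pow_const _), hFeq]
      exact rpow_split_le _ _ _ hp hr0
    · simp only [eNorm, hs1, if_false, hsr, one_mul]
      rw [hr, one_div_one_div]

end KEY
/-- Popa–Sinnamon inequality, second form: for `n ≥ 2` and exponents `q₁, …, qₙ ∈ (0,∞]`
with `Σ 1/qⱼ ≤ 1`, setting `1/sⱼ = 1/qⱼ + (1/(n−1))(1 − Σ 1/q_k)`, one has
`∫ f₁ ⋯ fₙ ≤ ∏ⱼ (∫_{Mⁿⱼ} (∫_{M_j} fⱼ^{qⱼ} dμⱼ)^{sⱼ/qⱼ} dμⁿⱼ)^{1/sⱼ}`, where the inner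
norm is over the `j`ᵗʰ variable and the outer norm over all the others, with `∞`
exponents interpreted as essential suprema. -/
theorem popa_sinnamon_second {n : ℕ} (hn : 2 ≤ n) {M : Fin n → Type*}
    [∀ k, MeasurableSpace (M k)] (μ : ∀ k, Measure (M k)) [∀ k, SigmaFinite (μ k)]
    (q : Fin n → ℝ≥0∞) (hq : ∀ j, 0 < q j) (hq1 : ∑ k : Fin n, (q k)⁻¹ ≤ 1)
    (f : Fin n → (∀ k, M k) → ℝ≥0∞) (hf : ∀ j, Measurable (f j)) :
    ∫⁻ x, ∏ j : Fin n, f j x ∂(Measure.pi μ) ≤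
      ∏ j : Fin n,
        eNorm (Measure.pi fun k : {k : Fin n // k ≠ j} => μ k)
          ((q j)⁻¹ + ((n : ℝ≥0∞) - 1)⁻¹ * (1 - ∑ k : Fin n, (q k)⁻¹))⁻¹
          (fun y => eNorm (μ j) (q j)
            (fun t => f j (glueAt j t y))) := by
  classical
  set β : ℝ≥0∞ := ((n : ℝ≥0∞) - 1)⁻¹ * (1 - ∑ k : Fin n, (q k)⁻¹) with hβdef
  have hn1 : ((n : ℝ≥0∞) - 1) = ((n - 1 : ℕ) : ℝ≥0∞) := by simp
  have hn' : (0 : ℝ) < (n : ℝ) - 1 := by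
    have : (2 : ℝ) ≤ n := by exact_mod_cast hn
    linarith
  have hqi : ∀ j, (q j)⁻¹ ≠ ∞ := fun j => ENNReal.inv_ne_top.mpr (hq j).ne'
  have hβ : β ≠ ∞ := by
    refine ENNReal.mul_ne_top ?_ (by simp)
    rw [hn1, ENNReal.inv_ne_top]
    exact_mod_cast (by omega : n - 1 ≠ 0)
  have hbr : β.toReal = (1 / ((n : ℝ) - 1)) * (1 - ∑ k, ((q k)⁻¹).toReal) := by
    rw [hβdef, ENNReal.toReal_mul, ENNReal.toReal_inv, hn1,
      ENNReal.toReal_sub_of_le hq1 ENNReal.one_ne_top, ENNReal.toReal_sum fun k _ => hqi k,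
      ENNReal.toReal_natCast, Nat.cast_sub (by omega)]
    simp
  have hA : 0 ≤ 1 - ∑ k, ((q k)⁻¹).toReal := by
    rw [← ENNReal.toReal_sum fun k _ => hqi k, sub_nonneg]
    simpa using ENNReal.toReal_mono ENNReal.one_ne_top hq1
  set N : Fin n → ℝ≥0∞ := fun j =>
    eNorm (Measure.pi fun k : {k : Fin n // k ≠ j} => μ k) ((q j)⁻¹ + β)⁻¹
      (fun y => eNorm (μ j) (q j) (fun t => f j (glueAt j t y))) with hNdef
  change _ ≤ ∏ j, N j
  by_cases h0 : ∃ j, N j = 0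
  · obtain ⟨j, hj⟩ := h0
    have hs0 : ((q j)⁻¹ + β)⁻¹ ≠ 0 :=
      ENNReal.inv_ne_zero.mpr (ENNReal.add_ne_top.mpr ⟨hqi j, hβ⟩)
    have hFm := measurable_eNorm (μ j) (q j) (fun p => f j (glueAt j p.1 p.2))
      ((hf j).comp (measurable_glue j))
    have hz := eNorm_zero_ae _ _ hs0 _ hFm hj
    have hfz : ∀ᵐ x ∂(Measure.pi μ), f j x = 0 := by
      refine ae_glue μ j _ (hf j (measurableSet_singleton 0)) ?_
      filter_upwards [hz] with y hy
      exact eNorm_zero_ae _ _ (hq j).ne' _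
        ((hf j).comp ((measurable_glue j).comp (measurable_id.prodMk measurable_const))) hy
    rw [lintegral_eq_zero_of_ae_eq_zero]
    · exact zero_le
    · filter_upwards [hfz] with x hx
      exact Finset.prod_eq_zero (Finset.mem_univ j) hx
  by_cases h1 : ∃ j, N j = ∞
  · obtain ⟨j, hj⟩ := h1
    push Not at h0
    rw [← Finset.mul_prod_erase _ _ (Finset.mem_univ j), hj, ENNReal.top_mul]
    · exact le_top
    · exact Finset.prod_ne_zero_iff.mpr fun k _ => h0 k
  push Not at h1
  choose K D G H hG hH hle hGD hHD hKD using fun j =>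
    key_factor μ j (q j) β (hq j) hβ (f j) (hf j) (h1 j)
  set A : ℝ := 1 - ∑ k, ((q k)⁻¹).toReal with hAdef
  set L : (∀ k, M k) → ℝ≥0∞ := fun x => ∏ j, H j (psRes j x) ^ (1 / ((n : ℝ) - 1)) with hL
  have hLm : Measurable L := Finset.measurable_fun_prod _ fun j _ =>
    ((hH j).comp (measurable_psRes j)).pow_const _
  have hGm : Measurable fun x => ∏ j, G j x ^ ((q j)⁻¹).toReal :=
    Finset.measurable_fun_prod _ fun j _ => (hG j).pow_const _
  have hLA : ∀ x, ∏ j, H j (psRes j x) ^ β.toReal = L x ^ A := by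
    intro x
    rw [hL, ← ENNReal.prod_rpow_of_nonneg hA]
    exact Finset.prod_congr rfl fun j _ => by rw [← ENNReal.rpow_mul, hbr]
  calc ∫⁻ x, ∏ j, f j x ∂(Measure.pi μ)
      ≤ ∫⁻ x, (∏ j, K j) * (L x ^ A * ∏ j, G j x ^ ((q j)⁻¹).toReal) ∂(Measure.pi μ) := by
        refine lintegral_mono_ae ?_
        filter_upwards [ae_all_iff.mpr hle] with x hx
        refine (Finset.prod_le_prod' fun j _ => hx j).trans_eq ?_
        rw [Finset.prod_mul_distrib, Finset.prod_mul_distrib, hLA]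
        ring
    _ = (∏ j, K j) * ∫⁻ x, L x ^ A * ∏ j, G j x ^ ((q j)⁻¹).toReal ∂(Measure.pi μ) :=
        lintegral_const_mul _ ((hLm.pow_const _).mul hGm)
    _ ≤ (∏ j, K j) * ((∫⁻ x, L x ∂(Measure.pi μ)) ^ A *
          ∏ j, (∫⁻ x, G j x ∂(Measure.pi μ)) ^ ((q j)⁻¹).toReal) := by
        gcongr
        exact ENNReal.lintegral_mul_prod_norm_pow_le Finset.univ hLm.aemeasurable
          (fun j _ => (hG j).aemeasurable) _ (by rw [hAdef]; ring) hA
          (fun j _ => ENNReal.toReal_nonneg)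
    _ ≤ (∏ j, K j) * ((∏ j, D j ^ (1 / ((n : ℝ) - 1))) ^ A *
          ∏ j, D j ^ ((q j)⁻¹).toReal) := by
        refine mul_le_mul_right (mul_le_mul' (ENNReal.rpow_le_rpow ?_ hA) ?_) _
        · refine (loomis_whitney μ hn H hH).trans (Finset.prod_le_prod' fun j _ => ?_)
          exact ENNReal.rpow_le_rpow (hHD j) (by positivity)
        · exact Finset.prod_le_prod' fun j _ =>
            ENNReal.rpow_le_rpow (hGD j) ENNReal.toReal_nonneg
    _ = ∏ j, N j := by
        rw [← ENNReal.prod_rpow_of_nonneg hA, ← Finset.prod_mul_distrib,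
          ← Finset.prod_mul_distrib]
        refine Finset.prod_congr rfl fun j _ => ?_
        rw [← ENNReal.rpow_mul, ← hbr, ← ENNReal.rpow_add_of_nonneg _ _ ENNReal.toReal_nonneg
          ENNReal.toReal_nonneg, add_comm]
        exact hKD j
end
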